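/- Let (R,m) be an almost Cohen-Macaulay noetherian local ring, M an R-module finite over a local homomorphism with Gid_R(M) < ∞, and x ∈ m a non-zerodivisor on R and on M. Then Gid_{R/xR}(M/xM) = Gid_R(M) − 1. -/

import Mathlib

open CategoryTheory IsLocalRing

universe u

noncomputable section

/-- Depth of a local ring: the supremum of lengths of regular sequences in the maximal ideal. -/
noncomputable def ringDepth (A : Type u) [CommRing A] [IsLocalRing A] : ℕ∞ :=
  sSup {c : ℕ∞ | ∃ rs : List A, c = rs.length ∧ (∀ x ∈ rs, x ∈ maximalIdeal A) ∧
    RingTheory.Sequence.IsRegular A rs}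

/-- Krull dimension of a module: the Krull dimension of its support. -/
noncomputable def moduleDim (R : Type u) [CommRing R] (M : Type u) [AddCommGroup M] [Module R M] :
    WithBot (WithTop ℕ) :=
  Order.krullDim (Module.support R M)

/-- A module is Gorenstein injective if it is a kernel in a complete exact complex of
injective modules which stays exact after applying `Hom(J, -)` for every injective `J`. -/
def IsGorensteinInjective (R : Type u) [CommRing R] (G : Type u) [AddCommGroup G] [Module R G] :
    Prop :=
  ∃ (I : ℤ → ModuleCat.{u} R) (d : ∀ n : ℤ, I n →ₗ[R] I (n - 1)),
    (∀ n, Injective (I n)) ∧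
    (∀ n : ℤ, Function.Exact (d n) (d (n - 1))) ∧
    (∀ J : ModuleCat.{u} R, Injective J → ∀ n : ℤ,
      Function.Exact (fun f : J →ₗ[R] I n => (d n).comp f)
        (fun f : J →ₗ[R] I (n - 1) => (d (n - 1)).comp f)) ∧
    Nonempty (G ≃ₗ[R] LinearMap.ker (d 0))

/-- `HasGidLE R M n` : there is an exact sequence `0 → M → G⁰ → ⋯ → Gⁿ → 0`
with all `Gⁱ` Gorenstein injective. -/
def HasGidLE (R : Type u) [CommRing R] (M : Type u) [AddCommGroup M] [Module R M] (n : ℕ) : Prop :=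
  ∃ (G : ℕ → ModuleCat.{u} R) (e : M →ₗ[R] G 0) (d : ∀ i : ℕ, G i →ₗ[R] G (i + 1)),
    (∀ i, IsGorensteinInjective R (G i)) ∧
    Function.Injective e ∧
    Function.Exact e (d 0) ∧
    (∀ i, Function.Exact (d i) (d (i + 1))) ∧
    (∀ i, n < i → Subsingleton (G i))

/-- Gorenstein injective dimension. -/
noncomputable def Gid (R : Type u) [CommRing R] (M : Type u) [AddCommGroup M] [Module R M] :
    ℕ∞ :=
  sInf {c : ℕ∞ | ∃ n : ℕ, c = n ∧ HasGidLE R M n}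

/-- `HasInjDimLE R M n` : there is an exact sequence `0 → M → I⁰ → ⋯ → Iⁿ → 0`
with all `Iⁱ` injective. -/
def HasInjDimLE (R : Type u) [CommRing R] (M : Type u) [AddCommGroup M] [Module R M] (n : ℕ) :
    Prop :=
  ∃ (I : ℕ → ModuleCat.{u} R) (e : M →ₗ[R] I 0) (d : ∀ i : ℕ, I i →ₗ[R] I (i + 1)),
    (∀ i, Injective (I i)) ∧
    Function.Injective e ∧
    Function.Exact e (d 0) ∧
    (∀ i, Function.Exact (d i) (d (i + 1))) ∧
    (∀ i, n < i → Subsingleton (I i))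

/-- Injective dimension. -/
noncomputable def injDim (R : Type u) [CommRing R] (M : Type u) [AddCommGroup M] [Module R M] :
    ℕ∞ :=
  sInf {c : ℕ∞ | ∃ n : ℕ, c = n ∧ HasInjDimLE R M n}

/-- `HasProjDimLE R M n` : there is an exact sequence `0 → Pₙ → ⋯ → P₀ → M → 0`
with all `Pᵢ` projective. -/
def HasProjDimLE (R : Type u) [CommRing R] (M : Type u) [AddCommGroup M] [Module R M] (n : ℕ) :
    Prop :=
  ∃ (P : ℕ → ModuleCat.{u} R) (e : P 0 →ₗ[R] M) (d : ∀ i : ℕ, P (i + 1) →ₗ[R] P i),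
    (∀ i, Projective (P i)) ∧
    Function.Surjective e ∧
    Function.Exact (d 0) e ∧
    (∀ i, Function.Exact (d (i + 1)) (d i)) ∧
    (∀ i, n < i → Subsingleton (P i))

/-- Width of a module over a local ring: `inf { i | Torᵢ(k, L) ≠ 0 }`. -/
noncomputable def moduleWidth (A : Type u) [CommRing A] [IsLocalRing A] (L : Type u)
    [AddCommGroup L] [Module A L] : ℕ∞ :=
  sInf {c : ℕ∞ | ∃ i : ℕ, c = i ∧
    ¬ Subsingleton (((Tor (ModuleCat.{u} A) i).obj
      (ModuleCat.of A (ResidueField A))).obj (ModuleCat.of A L))}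

section LongExactSequences

open Abelian

variable {R : Type u} [CommRing R] {A B C : Type u} [AddCommGroup A] [AddCommGroup B]
  [AddCommGroup C] [Module R A] [Module R B] [Module R C] {f : A →ₗ[R] B} {g : B →ₗ[R] C}

lemma exists_shortExact_of_exact (hf : Function.Injective f) (hfg : Function.Exact f g)
    (hg : Function.Surjective g) :
    ∃ (w : ModuleCat.ofHom f ≫ ModuleCat.ofHom g = 0),
      (ShortComplex.mk (ModuleCat.ofHom f) (ModuleCat.ofHom g) w).ShortExact :=
  ⟨(ModuleCat.shortComplexOfCompEqZero f g hfg.linearMap_comp_eq_zero).zero,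
    ModuleCat.shortComplex_shortExact
      (ModuleCat.shortComplexOfCompEqZero f g hfg.linearMap_comp_eq_zero) hfg hf hg⟩

lemma subsingleton_ext_left (hf : Function.Injective f) (hfg : Function.Exact f g)
    (hg : Function.Surjective g) (J : ModuleCat.{u} R) (i : ℕ)
    (hC : Subsingleton (Ext J (ModuleCat.of R C) i))
    (hB : Subsingleton (Ext J (ModuleCat.of R B) (i + 1))) :
    Subsingleton (Ext J (ModuleCat.of R A) (i + 1)) := by
  obtain ⟨w, hS⟩ := exists_shortExact_of_exact hf hfg hg
  refine subsingleton_of_forall_eq 0 fun y => ?_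
  obtain ⟨z, rfl⟩ := Ext.covariant_sequence_exact₁ J hS y (hB.elim _ _) rfl
  rw [hC.elim z 0, Ext.zero_comp]

lemma subsingleton_ext_middle (hf : Function.Injective f) (hfg : Function.Exact f g)
    (hg : Function.Surjective g) (J : ModuleCat.{u} R) (i : ℕ)
    (hA : Subsingleton (Ext J (ModuleCat.of R A) i))
    (hC : Subsingleton (Ext J (ModuleCat.of R C) i)) :
    Subsingleton (Ext J (ModuleCat.of R B) i) := by
  obtain ⟨w, hS⟩ := exists_shortExact_of_exact hf hfg hg
  refine subsingleton_of_forall_eq 0 fun y => ?_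
  obtain ⟨z, rfl⟩ := Ext.covariant_sequence_exact₂ J hS y (hC.elim _ _)
  rw [hA.elim z 0, Ext.zero_comp]

lemma subsingleton_ext_right (hf : Function.Injective f) (hfg : Function.Exact f g)
    (hg : Function.Surjective g) (J : ModuleCat.{u} R) (i : ℕ)
    (hB : Subsingleton (Ext J (ModuleCat.of R B) i))
    (hA : Subsingleton (Ext J (ModuleCat.of R A) (i + 1))) :
    Subsingleton (Ext J (ModuleCat.of R C) i) := by
  obtain ⟨w, hS⟩ := exists_shortExact_of_exact hf hfg hg
  refine subsingleton_of_forall_eq 0 fun y => ?_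
  obtain ⟨z, rfl⟩ := Ext.covariant_sequence_exact₃ J hS y rfl (hA.elim _ _)
  rw [hB.elim z 0, Ext.zero_comp]

lemma subsingleton_ext_of_left (hf : Function.Injective f) (hfg : Function.Exact f g)
    (hg : Function.Surjective g) (Y : ModuleCat.{u} R) (i : ℕ)
    (hB : Subsingleton (Ext (ModuleCat.of R B) Y i))
    (hC : Subsingleton (Ext (ModuleCat.of R C) Y (i + 1))) :
    Subsingleton (Ext (ModuleCat.of R A) Y i) := by
  obtain ⟨w, hS⟩ := exists_shortExact_of_exact hf hfg hg
  refine subsingleton_of_forall_eq 0 fun y => ?_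
  obtain ⟨z, rfl⟩ := Ext.contravariant_sequence_exact₁ hS Y y (add_comm 1 i) (hC.elim _ _)
  rw [hB.elim z 0, Ext.comp_zero]

lemma subsingleton_ext_of_middle (hf : Function.Injective f) (hfg : Function.Exact f g)
    (hg : Function.Surjective g) (Y : ModuleCat.{u} R) (i : ℕ)
    (hA : Subsingleton (Ext (ModuleCat.of R A) Y i))
    (hC : Subsingleton (Ext (ModuleCat.of R C) Y i)) :
    Subsingleton (Ext (ModuleCat.of R B) Y i) := by
  obtain ⟨w, hS⟩ := exists_shortExact_of_exact hf hfg hg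
  refine subsingleton_of_forall_eq 0 fun y => ?_
  obtain ⟨z, rfl⟩ := Ext.contravariant_sequence_exact₂ hS Y y (hA.elim _ _)
  rw [hC.elim z 0, Ext.comp_zero]

/-- Vanishing of `Ext¹(J, A)` lets maps out of `J` lift along `B → B / A`. -/
lemma exists_lift_of_subsingleton_ext (hf : Function.Injective f) (hfg : Function.Exact f g)
    (hg : Function.Surjective g) (J : ModuleCat.{u} R)
    (hA : Subsingleton (Ext J (ModuleCat.of R A) 1)) (h : J →ₗ[R] C) :
    ∃ k : J →ₗ[R] B, g.comp k = h := by
  obtain ⟨w, hS⟩ := exists_shortExact_of_exact hf hfg hg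
  obtain ⟨z, hz⟩ := Ext.covariant_sequence_exact₃ J hS (Ext.mk₀ (ModuleCat.ofHom h))
    (zero_add 1) (hA.elim _ _)
  obtain ⟨k, rfl⟩ := Ext.homEquiv₀.symm.surjective z
  refine ⟨k.hom, ?_⟩
  simp only [Ext.homEquiv₀_symm_apply, Ext.mk₀_comp_mk₀] at hz
  have := Ext.homEquiv₀.symm.injective hz
  exact congrArg ModuleCat.Hom.hom this

/-- If maps out of `J` lift along `B → B / A` and `Ext¹(J, B)` vanishes,
then `Ext¹(J, A)` vanishes. -/
lemma subsingleton_ext_one_of_lift (hf : Function.Injective f) (hfg : Function.Exact f g)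
    (hg : Function.Surjective g) (J : ModuleCat.{u} R)
    (hB : Subsingleton (Ext J (ModuleCat.of R B) 1))
    (hJ : ∀ h : J →ₗ[R] C, ∃ k : J →ₗ[R] B, g.comp k = h) :
    Subsingleton (Ext J (ModuleCat.of R A) 1) := by
  obtain ⟨w, hS⟩ := exists_shortExact_of_exact hf hfg hg
  refine subsingleton_of_forall_eq 0 fun y => ?_
  obtain ⟨z, rfl⟩ := Ext.covariant_sequence_exact₁ J hS y (hB.elim _ _) (zero_add 1)
  obtain ⟨h, rfl⟩ := Ext.homEquiv₀.symm.surjective z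
  obtain ⟨k, hk⟩ := hJ h.hom
  have : h = ModuleCat.ofHom k ≫ ModuleCat.ofHom g := by
    ext1; exact hk.symm
  subst this
  rw [Ext.homEquiv₀_symm_apply, ← Ext.mk₀_comp_mk₀, Ext.comp_assoc_of_second_deg_zero,
    hS.comp_extClass, Ext.comp_zero]

lemma subsingleton_ext_congr {A' : Type u} [AddCommGroup A'] [Module R A'] (e : A ≃ₗ[R] A')
    (J : ModuleCat.{u} R) (i : ℕ) (h : Subsingleton (Ext J (ModuleCat.of R A) i)) :
    Subsingleton (Ext J (ModuleCat.of R A') i) := by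
  refine subsingleton_of_forall_eq 0 fun y => ?_
  rw [← y.comp_mk₀_id, ← e.toModuleIso.inv_hom_id, ← Ext.mk₀_comp_mk₀,
    ← Ext.comp_assoc_of_second_deg_zero, h.elim (y.comp (Ext.mk₀ e.toModuleIso.inv) _) 0,
    Ext.zero_comp]

lemma subsingleton_ext_of_injective (I : Type u) [AddCommGroup I] [Module R I]
    (hI : Injective (ModuleCat.of R I)) (J : ModuleCat.{u} R) (i : ℕ) :
    Subsingleton (Ext J (ModuleCat.of R I) (i + 1)) :=
  subsingleton_of_forall_eq 0 fun y => Ext.eq_zero_of_injective y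

end LongExactSequences

section GorensteinInjective

open Abelian

variable {R : Type u} [CommRing R]

variable (R) in
/-- `Extⁱ(J, G) = 0` for all injective modules `J` and all `i ≥ 1`. -/
def IsExtOrthogonal (G : Type u) [AddCommGroup G] [Module R G] : Prop :=
  ∀ J : ModuleCat.{u} R, Injective J → ∀ i, Subsingleton (Ext J (ModuleCat.of R G) (i + 1))

variable (R) in
/-- There is a short exact sequence `0 → A → I → B → 0` with `I` injective. -/
def InjectiveStep (A B : Type u) [AddCommGroup A] [Module R A] [AddCommGroup B] [Module R B] :
    Prop :=
  ∃ (I : ModuleCat.{u} R) (i : A →ₗ[R] I) (p : I →ₗ[R] B), Injective I ∧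
    Function.Injective i ∧ Function.Exact i p ∧ Function.Surjective p

lemma IsExtOrthogonal.congr {A B : Type u} [AddCommGroup A] [Module R A] [AddCommGroup B]
    [Module R B] (e : A ≃ₗ[R] B) (h : IsExtOrthogonal R A) : IsExtOrthogonal R B :=
  fun J hJ i => subsingleton_ext_congr e J _ (h J hJ i)

lemma InjectiveStep.congr_right {A B B' : Type u} [AddCommGroup A] [Module R A] [AddCommGroup B]
    [Module R B] [AddCommGroup B'] [Module R B'] (e : B ≃ₗ[R] B') (h : InjectiveStep R A B) :
    InjectiveStep R A B' := by
  obtain ⟨I, i, p, hI, hi, hip, hp⟩ := h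
  exact ⟨I, i, e.toLinearMap.comp p, hI, hi, fun y => by simp [← hip y], e.surjective.comp hp⟩

lemma isGorensteinInjective_of_injectiveStep (K : ℤ → ModuleCat.{u} R)
    (hK : ∀ n, InjectiveStep R (K n) (K (n - 1))) (ho : ∀ n, IsExtOrthogonal R (K n))
    {G : Type u} [AddCommGroup G] [Module R G] (e : G ≃ₗ[R] K 0) :
    IsGorensteinInjective R G := by
  choose I i p hI hi hip hp using hK
  refine ⟨I, fun n => (i (n - 1)).comp (p n), hI, fun n y => ?_, fun J hJ n f => ?_, ?_⟩
  · constructor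
    · intro hy
      have : p (n - 1) y = 0 := hi _ (by simpa using hy)
      obtain ⟨z, rfl⟩ := (hip (n - 1) y).1 this
      obtain ⟨w, rfl⟩ := hp n z
      exact ⟨w, rfl⟩
    · rintro ⟨w, rfl⟩
      simp [(hip (n - 1)).apply_apply_eq_zero]
  · constructor
    · intro hf
      have hf' : ∀ j, p (n - 1) (f j) = 0 := fun j =>
        hi _ (by simpa using LinearMap.congr_fun hf j)
      let f' : J →ₗ[R] LinearMap.range (i (n - 1)) :=
        f.codRestrict _ fun j => (hip (n - 1) _).1 (hf' j)
      let f'' : J →ₗ[R] K (n - 1) := (LinearEquiv.ofInjective _ (hi (n - 1))).symm.toLinearMap.comp f'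
      obtain ⟨k, hk⟩ := exists_lift_of_subsingleton_ext (hi n) (hip n) (hp n) J (ho n J hJ 0) f''
      refine ⟨k, ?_⟩
      ext j
      have h1 := LinearMap.congr_fun hk j
      have h2 : (LinearEquiv.ofInjective _ (hi (n - 1))) (f'' j) = f' j := by simp [f'']
      have h3 := congrArg Subtype.val h2
      simp only [LinearMap.comp_apply] at h1 ⊢
      rw [h1]
      exact h3
    · rintro ⟨w, rfl⟩
      ext j
      simp [(hip (n - 1)).apply_apply_eq_zero]
  · have : LinearMap.ker ((i (0 - 1)).comp (p 0)) = LinearMap.range (i 0) := by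
      rw [LinearMap.ker_comp_of_ker_eq_bot _ (LinearMap.ker_eq_bot.2 (hi _)), (hip 0).linearMap_ker_eq]
    exact ⟨(e.trans (LinearEquiv.ofInjective _ (hi 0))).trans (LinearEquiv.ofEq _ _ this.symm)⟩

lemma IsGorensteinInjective.exists_injectiveStep {G : Type u} [AddCommGroup G] [Module R G]
    (hG : IsGorensteinInjective R G) :
    ∃ K : ℤ → ModuleCat.{u} R, (∀ n, InjectiveStep R (K n) (K (n - 1))) ∧
      (∀ n, IsExtOrthogonal R (K n)) ∧ Nonempty (G ≃ₗ[R] K 0) := by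
  obtain ⟨I, d, hI, hd, hJ, he⟩ := hG
  have key : ∀ n, ∃ p : I n →ₗ[R] LinearMap.ker (d (n - 1)),
      Function.Exact (LinearMap.ker (d n)).subtype p ∧ Function.Surjective p ∧
      ∀ y, (p y : I (n - 1)) = d n y := fun n => by
    refine ⟨(d n).codRestrict _ fun y => (hd n).apply_apply_eq_zero y, fun y => ?_, fun y => ?_,
      fun y => rfl⟩
    · exact ⟨fun h => ⟨⟨y, congrArg Subtype.val h⟩, rfl⟩, by rintro ⟨z, rfl⟩; exact Subtype.ext z.2⟩
    · obtain ⟨w, hw⟩ := (hd n y).1 y.2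
      exact ⟨w, Subtype.ext hw⟩
  choose p hp1 hp2 hp3 using key
  refine ⟨fun n => ModuleCat.of R (LinearMap.ker (d n)), fun n => ⟨I n, Submodule.subtype _, p n,
    hI n, Subtype.val_injective, hp1 n, hp2 n⟩, fun n J hJ' i => ?_, he⟩
  induction i generalizing n with
  | zero =>
    refine subsingleton_ext_one_of_lift Subtype.val_injective (hp1 n) (hp2 n) J
      (subsingleton_ext_of_injective (I n) (hI n) J 0) fun h => ?_
    obtain ⟨k, hk⟩ := (hJ J hJ' n ((Submodule.subtype _).comp h)).1 (by ext j; exact (h j).2)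
    refine ⟨k, ?_⟩
    ext j
    simpa [hp3] using LinearMap.congr_fun hk j
  | succ i ih =>
    exact subsingleton_ext_left Subtype.val_injective (hp1 n) (hp2 n) J _ (ih (n - 1))
      (subsingleton_ext_of_injective (I n) (hI n) J _)

lemma exists_injectiveStep_quotient (B : Type u) [AddCommGroup B] [Module R B] :
    ∃ (I : ModuleCat.{u} R) (i : B →ₗ[R] I), Injective I ∧ Function.Injective i :=
  ⟨Injective.under (ModuleCat.of R B), (Injective.ι (ModuleCat.of R B)).hom, inferInstance,
    (ModuleCat.mono_iff_injective _).1 inferInstance⟩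

lemma IsExtOrthogonal.exists_injectiveStep {B : Type u} [AddCommGroup B] [Module R B]
    (hB : IsExtOrthogonal R B) :
    ∃ C : ModuleCat.{u} R, IsExtOrthogonal R C ∧ InjectiveStep R B C := by
  obtain ⟨I, i, hI, hi⟩ := exists_injectiveStep_quotient (R := R) B
  refine ⟨ModuleCat.of R (I ⧸ LinearMap.range i), fun J hJ n => ?_, I, i,
    (LinearMap.range i).mkQ, hI, hi, LinearMap.exact_map_mkQ_range i, Submodule.mkQ_surjective _⟩
  exact subsingleton_ext_right hi (LinearMap.exact_map_mkQ_range i) (Submodule.mkQ_surjective _) J _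
    (subsingleton_ext_of_injective I hI J n) (hB J hJ (n + 1))

/-- Coinduction principle for Gorenstein injective modules. -/
lemma isGorensteinInjective_of_coind (P : ModuleCat.{u} R → Prop)
    (hP : ∀ B, P B → IsExtOrthogonal R B ∧ ∃ B', P B' ∧ InjectiveStep R B' B)
    {G : Type u} [AddCommGroup G] [Module R G] (hG : P (ModuleCat.of R G)) :
    IsGorensteinInjective R G := by
  choose ho s hs hs' using hP
  let left : ℕ → {B : ModuleCat.{u} R // P B} :=
    fun n => Nat.rec ⟨ModuleCat.of R G, hG⟩ (fun _ B => ⟨s B.1 B.2, hs B.1 B.2⟩) n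
  have hr : ∀ B : {B : ModuleCat.{u} R // IsExtOrthogonal R B},
      ∃ C : {B : ModuleCat.{u} R // IsExtOrthogonal R B}, InjectiveStep R B.1 C.1 := fun B => by
    obtain ⟨C, hC, h⟩ := B.2.exists_injectiveStep
    exact ⟨⟨C, hC⟩, h⟩
  choose r hr using hr
  let right : ℕ → {B : ModuleCat.{u} R // IsExtOrthogonal R B} :=
    fun n => Nat.rec ⟨ModuleCat.of R G, ho _ hG⟩ (fun _ B => r B) n
  let K : ℤ → ModuleCat.{u} R
    | Int.ofNat n => (left n).1
    | Int.negSucc n => (right (n + 1)).1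
  refine isGorensteinInjective_of_injectiveStep K ?_ ?_ (LinearEquiv.refl R G)
  · rintro ((_ | n) | n)
    · exact hr ⟨ModuleCat.of R G, ho _ hG⟩
    · have : (Int.ofNat (n + 1)) - 1 = Int.ofNat n := by simp
      rw [this]
      exact hs' (left n).1 (left n).2
    · have : (Int.negSucc n) - 1 = Int.negSucc (n + 1) := by lia
      rw [this]
      exact hr (right (n + 1))
  · rintro (n | n)
    · exact ho _ (left n).2
    · exact (right (n + 1)).2

lemma IsGorensteinInjective.isExtOrthogonal {G : Type u} [AddCommGroup G] [Module R G]
    (hG : IsGorensteinInjective R G) : IsExtOrthogonal R G := by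
  obtain ⟨K, -, ho, ⟨e⟩⟩ := hG.exists_injectiveStep
  exact (ho 0).congr e.symm

lemma IsGorensteinInjective.exists_cover {G : Type u} [AddCommGroup G] [Module R G]
    (hG : IsGorensteinInjective R G) :
    ∃ G' : ModuleCat.{u} R, IsGorensteinInjective R G' ∧ InjectiveStep R G' G := by
  obtain ⟨K, hK, ho, ⟨e⟩⟩ := hG.exists_injectiveStep
  refine ⟨K 1, isGorensteinInjective_of_coind (fun B => ∃ n, B = K n) ?_ ⟨1, rfl⟩,
    (hK 1).congr_right e.symm⟩
  rintro _ ⟨n, rfl⟩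
  refine ⟨ho n, K (n + 1), ⟨_, rfl⟩, ?_⟩
  have := hK (n + 1)
  rwa [add_sub_cancel_right] at this

lemma isGorensteinInjective_of_injective {I : Type u} [AddCommGroup I] [Module R I]
    (hI : Injective (ModuleCat.of R I)) : IsGorensteinInjective R I := by
  refine isGorensteinInjective_of_coind (fun B => Injective B) (fun B hB => ⟨fun J _ i =>
    subsingleton_ext_of_injective B hB J i, ModuleCat.of R PUnit, ?_, B, 0, LinearMap.id, hB,
    Function.injective_of_subsingleton _, fun y => ?_, Function.surjective_id⟩) hI
  · exact (ModuleCat.isZero_of_subsingleton _).injective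
  · simp [eq_comm]

lemma IsGorensteinInjective.congr {A B : Type u} [AddCommGroup A] [Module R A] [AddCommGroup B]
    [Module R B] (e : A ≃ₗ[R] B) (h : IsGorensteinInjective R A) : IsGorensteinInjective R B := by
  obtain ⟨I, d, h1, h2, h3, ⟨e'⟩⟩ := h
  exact ⟨I, d, h1, h2, h3, ⟨e.symm.trans e'⟩⟩

end GorensteinInjective

section GorensteinInjectiveDimension

open Abelian

variable {R : Type u} [CommRing R]

variable (R) in
/-- There is a short exact sequence `0 → A → B → C → 0`. -/
def IsExtension (A B C : Type u) [AddCommGroup A] [Module R A] [AddCommGroup B] [Module R B]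
    [AddCommGroup C] [Module R C] : Prop :=
  ∃ (f : A →ₗ[R] B) (g : B →ₗ[R] C),
    Function.Injective f ∧ Function.Exact f g ∧ Function.Surjective g

variable {A B C : Type u} [AddCommGroup A] [Module R A] [AddCommGroup B] [Module R B]
    [AddCommGroup C] [Module R C]

lemma isExtension_ker {g : B →ₗ[R] C} (hg : Function.Surjective g) :
    IsExtension R (LinearMap.ker g) B C :=
  ⟨_, g, Subtype.val_injective, LinearMap.exact_subtype_ker_map g, hg⟩

lemma isExtension_range {f : A →ₗ[R] B} (hf : Function.Injective f) :
    IsExtension R A B (B ⧸ LinearMap.range f) :=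
  ⟨f, _, hf, LinearMap.exact_map_mkQ_range f, Submodule.mkQ_surjective _⟩

lemma IsExtension.congr_right {C' : Type u} [AddCommGroup C'] [Module R C'] (e : C ≃ₗ[R] C')
    (h : IsExtension R A B C) : IsExtension R A B C' := by
  obtain ⟨i, p, hi, hip, hp⟩ := h
  exact ⟨i, e.toLinearMap.comp p, hi, fun y => by simp [← hip y], e.surjective.comp hp⟩

lemma IsExtension.congr_left {A' : Type u} [AddCommGroup A'] [Module R A'] (e : A ≃ₗ[R] A')
    (h : IsExtension R A B C) : IsExtension R A' B C := by
  obtain ⟨i, p, hi, hip, hp⟩ := h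
  refine ⟨i.comp e.symm.toLinearMap, p, hi.comp e.symm.injective, fun y => ?_, hp⟩
  rw [hip y]
  exact (e.symm.surjective.range_comp i ▸ Iff.rfl)

lemma IsExtension.exists_equiv (h : IsExtension R A B C) :
    ∃ g : B →ₗ[R] C, Function.Surjective g ∧ Nonempty (A ≃ₗ[R] LinearMap.ker g) := by
  obtain ⟨f, g, hf, hfg, hg⟩ := h
  exact ⟨g, hg, ⟨(LinearEquiv.ofInjective f hf).trans
    (LinearEquiv.ofEq _ _ hfg.linearMap_ker_eq.symm)⟩⟩

lemma IsGorensteinInjective.exists_surjective {G : Type u} [AddCommGroup G] [Module R G]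
    (hG : IsGorensteinInjective R G) :
    ∃ (I : ModuleCat.{u} R) (p : I →ₗ[R] G), Injective I ∧ Function.Surjective p ∧
      IsGorensteinInjective R (LinearMap.ker p) := by
  obtain ⟨G', hG', I, i, p, hI, hi, hip, hp⟩ := hG.exists_cover
  exact ⟨I, p, hI, hp, hG'.congr ((LinearEquiv.ofInjective i hi).trans
    (LinearEquiv.ofEq _ _ hip.linearMap_ker_eq.symm))⟩

lemma injective_prod {I J : Type u} [AddCommGroup I] [Module R I] [AddCommGroup J] [Module R J]
    (hI : Injective (ModuleCat.of R I)) (hJ : Injective (ModuleCat.of R J)) :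
    Injective (ModuleCat.of R (I × J)) := by
  rw [← Module.injective_iff_injective_object] at *
  refine ⟨fun X Y _ _ _ _ f hf g => ?_⟩
  obtain ⟨h, hh⟩ := hI.out f hf ((LinearMap.fst R I J).comp g)
  obtain ⟨k, hk⟩ := hJ.out f hf ((LinearMap.snd R I J).comp g)
  exact ⟨h.prod k, fun x => by simp [hh, hk]⟩

/-- Horseshoe-type cover of an extension. -/
lemma exists_extension_cover {f : A →ₗ[R] B} {g : B →ₗ[R] C} (hf : Function.Injective f)
    (hfg : Function.Exact f g) (hg : Function.Surjective g) (hA : IsGorensteinInjective R A)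
    (hC : IsGorensteinInjective R C) :
    ∃ (A' B' C' : ModuleCat.{u} R), IsGorensteinInjective R A' ∧ IsGorensteinInjective R C' ∧
      IsExtension R A' B' C' ∧ InjectiveStep R B' B := by
  obtain ⟨IA, p, hIA, hp, hpk⟩ := hA.exists_surjective
  obtain ⟨IC, q, hIC, hq, hqk⟩ := hC.exists_surjective
  obtain ⟨h, hh⟩ := exists_lift_of_subsingleton_ext hf hfg hg IC (hA.isExtOrthogonal IC hIC 0) q
  have hh' : ∀ v, g (h v) = q v := LinearMap.congr_fun hh
  let φ : (IA × IC) →ₗ[R] B := (f.comp p).coprod h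
  have hgφ : ∀ w : IA × IC, g (φ w) = q w.2 := fun w => by
    simp [φ, hh', hfg.apply_apply_eq_zero]
  have hφ : Function.Surjective φ := fun b => by
    obtain ⟨v, hv⟩ := hq (g b)
    obtain ⟨a, ha⟩ := (hfg (b - h v)).1 (by rw [map_sub, hh', hv, sub_self])
    obtain ⟨u, rfl⟩ := hp a
    exact ⟨(u, v), by simp [φ, ha]⟩
  refine ⟨ModuleCat.of R (LinearMap.ker p), ModuleCat.of R (LinearMap.ker φ),
    ModuleCat.of R (LinearMap.ker q), hpk, hqk, ⟨?_, ?_, ?_, ?_, ?_⟩,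
    ModuleCat.of R (IA × IC), _, φ, injective_prod hIA hIC, Subtype.val_injective,
    LinearMap.exact_subtype_ker_map φ, hφ⟩
  · exact ((LinearMap.inl R IA IC).comp (Submodule.subtype _)).codRestrict _ fun u => by
      have := u.2
      simp_all [φ]
  · exact ((LinearMap.snd R IA IC).comp (Submodule.subtype _)).codRestrict _ fun w => by
      have := hgφ w.1
      rw [w.2, map_zero] at this
      exact this.symm
  · intro u v huv
    have := congrArg (fun w => w.1.1) huv
    exact Subtype.ext this
  · intro w
    constructor
    · intro hw
      have h2 : w.1.2 = 0 := congrArg Subtype.val hw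
      have h1 : p w.1.1 = 0 := hf (by
        have hw : φ w.1 = 0 := w.2
        have hφw : φ w.1 = f (p w.1.1) + h w.1.2 := rfl
        rw [map_zero, ← hw, hφw, h2, map_zero, add_zero])
      exact ⟨⟨w.1.1, h1⟩, Subtype.ext (Prod.ext rfl h2.symm)⟩
    · rintro ⟨u, rfl⟩
      rfl
  · rintro ⟨v, hv⟩
    obtain ⟨a, ha⟩ := (hfg (h v)).1 (by rw [hh']; exact hv)
    obtain ⟨u, rfl⟩ := hp a
    exact ⟨⟨(-u, v), by simp [φ, ha]⟩, rfl⟩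

lemma IsExtension.isGorensteinInjective (h : IsExtension R A B C)
    (hA : IsGorensteinInjective R A) (hC : IsGorensteinInjective R C) :
    IsGorensteinInjective R B := by
  refine isGorensteinInjective_of_coind (fun B => ∃ A C : ModuleCat.{u} R,
    IsGorensteinInjective R A ∧ IsGorensteinInjective R C ∧ IsExtension R A B C) ?_
    ⟨ModuleCat.of R A, ModuleCat.of R C, hA, hC, h⟩
  rintro B ⟨A, C, hA, hC, f, g, hf, hfg, hg⟩
  refine ⟨fun J hJ i => subsingleton_ext_middle hf hfg hg J _ (hA.isExtOrthogonal J hJ i)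
    (hC.isExtOrthogonal J hJ i), ?_⟩
  obtain ⟨A', B', C', hA', hC', h, h'⟩ := exists_extension_cover hf hfg hg hA hC
  exact ⟨B', ⟨A', C', hA', hC', h⟩, h'⟩

lemma isExtension_ker_comp {I : Type u} [AddCommGroup I] [Module R I] {p : I →ₗ[R] B}
    (hp : Function.Surjective p) (g : B →ₗ[R] C) :
    IsExtension R (LinearMap.ker p) (LinearMap.ker (g.comp p)) (LinearMap.ker g) := by
  refine ⟨Submodule.inclusion (LinearMap.ker_le_ker_comp p g),
      (p.comp (Submodule.subtype _)).codRestrict _ fun w => w.2, Submodule.inclusion_injective _,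
      fun w => ⟨fun hw => ⟨⟨w.1, congrArg Subtype.val hw⟩, rfl⟩, ?_⟩, ?_⟩
  · rintro ⟨u, rfl⟩
    exact Subtype.ext u.2
  · rintro ⟨b, hb⟩
    obtain ⟨w, rfl⟩ := hp b
    exact ⟨⟨w, hb⟩, rfl⟩

lemma IsExtension.isGorensteinInjective_right (h : IsExtension R A B C)
    (hA : IsGorensteinInjective R A) (hB : IsGorensteinInjective R B) :
    IsGorensteinInjective R C := by
  refine isGorensteinInjective_of_coind (fun C => IsGorensteinInjective R C ∨
    ∃ A B : ModuleCat.{u} R, IsGorensteinInjective R A ∧ IsGorensteinInjective R B ∧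
      IsExtension R A B C) ?_ (Or.inr ⟨ModuleCat.of R A, ModuleCat.of R B, hA, hB, h⟩)
  rintro C (hC | ⟨A, B, hA, hB, h⟩)
  · obtain ⟨C', hC', h⟩ := hC.exists_cover
    exact ⟨hC.isExtOrthogonal, C', Or.inl hC', h⟩
  · constructor
    · obtain ⟨f, g, hf, hfg, hg⟩ := h
      exact fun J hJ i => subsingleton_ext_right hf hfg hg J _ (hB.isExtOrthogonal J hJ i)
        (hA.isExtOrthogonal J hJ _)
    · obtain ⟨g, hg, ⟨e⟩⟩ := h.exists_equiv
      obtain ⟨I, p, hI, hp, hpk⟩ := hB.exists_surjective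
      exact ⟨ModuleCat.of R (LinearMap.ker (g.comp p)),
        Or.inl ((isExtension_ker_comp hp g).isGorensteinInjective hpk (hA.congr e)), I, _, g.comp p, hI,
        Subtype.val_injective, LinearMap.exact_subtype_ker_map _, hg.comp hp⟩

/-- `GidLE R n M`: the module `M` has a coresolution of length `n` by Gorenstein injectives,
defined by recursion on `n`. -/
def GidLE (R : Type u) [CommRing R] :
    ℕ → ∀ (M : Type u) [AddCommGroup M] [Module R M], Prop
  | 0, M, _, _ => IsGorensteinInjective R M
  | n + 1, M, _, _ => ∃ G N : ModuleCat.{u} R, IsGorensteinInjective R G ∧ GidLE R n N ∧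
      IsExtension R M G N

lemma isGorensteinInjective_of_subsingleton (A : Type u) [AddCommGroup A] [Module R A]
    [Subsingleton A] : IsGorensteinInjective R A :=
  isGorensteinInjective_of_injective (ModuleCat.isZero_of_subsingleton _).injective

lemma GidLE.of_extension {n : ℕ} (h : IsExtension R A B C) (hA : IsGorensteinInjective R A)
    (hB : GidLE R n B) : GidLE R n C := by
  cases n with
  | zero => exact h.isGorensteinInjective_right hA hB
  | succ n =>
    obtain ⟨G, N, hG, hN, i, p, hi, hip, hp⟩ := hB
    obtain ⟨f, g, hf, hfg, hg⟩ := h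
    have hj : Function.Injective (i.comp f) := hi.comp hf
    let Q := G ⧸ LinearMap.range (i.comp f)
    let α : (B ⧸ LinearMap.range f) →ₗ[R] Q := Submodule.mapQ _ _ i (by
      rintro _ ⟨a, rfl⟩
      exact ⟨a, rfl⟩)
    let β : Q →ₗ[R] N := Submodule.liftQ _ p (by
      rintro _ ⟨a, rfl⟩
      exact hip.apply_apply_eq_zero _)
    have e : (B ⧸ LinearMap.range f) ≃ₗ[R] C :=
      (Submodule.quotEquivOfEq _ _ hfg.linearMap_ker_eq.symm).trans (g.quotKerEquivOfSurjective hg)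
    have hext : IsExtension R (B ⧸ LinearMap.range f) Q N := by
      refine ⟨α, β, ?_, ?_, ?_⟩
      · rw [injective_iff_map_eq_zero]
        intro b hb
        obtain ⟨b, rfl⟩ := Submodule.Quotient.mk_surjective _ b
        obtain ⟨a, ha⟩ := (Submodule.Quotient.mk_eq_zero _).1 hb
        exact (Submodule.Quotient.mk_eq_zero _).2 ⟨a, hi ha⟩
      · intro y
        obtain ⟨y, rfl⟩ := Submodule.Quotient.mk_surjective _ y
        constructor
        · intro hy
          obtain ⟨b, rfl⟩ := (hip y).1 hy
          exact ⟨Submodule.Quotient.mk b, rfl⟩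
        · rintro ⟨b, hb⟩
          obtain ⟨b, rfl⟩ := Submodule.Quotient.mk_surjective _ b
          rw [← hb]
          exact hip.apply_apply_eq_zero b
      · intro y
        obtain ⟨y, rfl⟩ := hp y
        exact ⟨Submodule.Quotient.mk y, rfl⟩
    exact ⟨ModuleCat.of R Q, N, (isExtension_range hj).isGorensteinInjective_right hA hG, hN,
      hext.congr_left e⟩

lemma HasGidLE.gidLE {n : ℕ} (h : HasGidLE R A n) : GidLE R n A := by
  induction n generalizing A with
  | zero =>
    obtain ⟨G, e, d, hG, he, hed, hd, hs⟩ := h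
    have := hs 1 one_pos
    refine (hG 0).congr (LinearEquiv.ofBijective e ⟨he, fun y => ?_⟩).symm
    exact (hed y).1 (Subsingleton.elim _ _)
  | succ n ih =>
    obtain ⟨G, e, d, hG, he, hed, hd, hs⟩ := h
    refine ⟨G 0, ModuleCat.of R (LinearMap.ker (d 1)), hG 0, ih ⟨fun i => G (i + 1),
      Submodule.subtype _, fun i => d (i + 1), fun i => hG _, Subtype.val_injective,
      LinearMap.exact_subtype_ker_map _, fun i => hd _, fun i hi => hs _ (by lia)⟩, e,
      (d 0).codRestrict _ fun y => (hd 0).apply_apply_eq_zero y, he, fun y => ?_, fun y => ?_⟩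
    · rw [← hed y]
      exact Subtype.ext_iff
    · obtain ⟨w, hw⟩ := (hd 0 y).1 y.2
      exact ⟨w, Subtype.ext hw⟩

lemma GidLE.hasGidLE {n : ℕ} (h : GidLE R n A) : HasGidLE R A n := by
  induction n generalizing A with
  | zero =>
    refine ⟨fun i => Nat.casesOn i (ModuleCat.of R A) fun _ => ModuleCat.of R PUnit,
      LinearMap.id, fun i => 0, ?_, Function.injective_id, fun y => ?_, fun i y => ?_, ?_⟩
    · rintro (_ | i)
      · exact h
      · exact isGorensteinInjective_of_subsingleton PUnit
    · simp
    · have : Subsingleton PUnit.{u+1} := inferInstance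
      exact ⟨fun _ => ⟨0, this.elim _ _⟩, fun _ => rfl⟩
    · rintro (_ | i) hi
      · exact absurd hi (lt_irrefl _)
      · exact inferInstanceAs (Subsingleton PUnit)
  | succ n ih =>
    obtain ⟨G, N, hG, hN, i, p, hi, hip, hp⟩ := h
    obtain ⟨G', e, d, hG', he, hed, hd, hs⟩ := ih hN
    refine ⟨fun i => Nat.casesOn i G G', i, fun i => Nat.casesOn i (e.comp p) d, ?_, hi,
      fun y => ?_, ?_, ?_⟩
    · rintro (_ | i)
      · exact hG
      · exact hG' i
    · rw [← hip y]
      exact ⟨fun h => he (by simpa using h), fun h => by simp [h]⟩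
    · rintro (_ | i) y
      · refine (hed y).trans ⟨?_, ?_⟩
        · rintro ⟨w, rfl⟩
          obtain ⟨w, rfl⟩ := hp w
          exact ⟨w, rfl⟩
        · rintro ⟨w, rfl⟩
          exact ⟨p w, rfl⟩
      · exact hd i y
    · rintro (_ | i) hi
      · exact absurd hi (Nat.not_lt_zero _)
      · exact hs i (by lia)

lemma gidLE_iff {n : ℕ} : GidLE R n A ↔ HasGidLE R A n := ⟨GidLE.hasGidLE, HasGidLE.gidLE⟩

end GorensteinInjectiveDimension

section TorsionReduction

open Abelian

variable {R : Type u} [CommRing R] (x : R)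
variable {A B C : Type u} [AddCommGroup A] [Module R A] [AddCommGroup B] [Module R B]
    [AddCommGroup C] [Module R C]

lemma exists_smul_eq_of_injective (hx : x ∈ nonZeroDivisors R) {I : Type u} [AddCommGroup I]
    [Module R I] (hI : Injective (ModuleCat.of R I)) (y : I) : ∃ z : I, x • z = y := by
  rw [← Module.injective_iff_injective_object] at hI
  obtain ⟨h, hh⟩ := hI.out (LinearMap.mulLeft R x)
    (fun a b hab => (mul_cancel_left_mem_nonZeroDivisors hx).1 hab) (LinearMap.toSpanSingleton R I y)
  refine ⟨h 1, ?_⟩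
  have := hh 1
  simp only [LinearMap.mulLeft_apply, LinearMap.toSpanSingleton_apply, one_smul] at this
  rw [← this, ← map_smul, smul_eq_mul]

lemma IsGorensteinInjective.exists_smul_eq (hx : x ∈ nonZeroDivisors R)
    (hA : IsGorensteinInjective R A) (y : A) : ∃ z : A, x • z = y := by
  obtain ⟨I, p, hI, hp, -⟩ := hA.exists_surjective
  obtain ⟨y, rfl⟩ := hp y
  obtain ⟨z, rfl⟩ := exists_smul_eq_of_injective x hx hI y
  exact ⟨p z, (map_smul p x z).symm⟩

/-- A linear map restricted to the submodules killed by `x`, over the quotient ring. -/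
def torsionByMap (f : A →ₗ[R] B) :
    Submodule.torsionBy R A x →ₗ[R ⧸ Ideal.span {x}] Submodule.torsionBy R B x :=
  LinearMap.extendScalarsOfSurjective (S := R ⧸ Ideal.span {x}) Ideal.Quotient.mk_surjective
    (f.restrict (p := Submodule.torsionBy R A x) (q := Submodule.torsionBy R B x) fun a ha => by
      rw [Submodule.mem_torsionBy_iff] at ha ⊢
      rw [← map_smul, ha, map_zero])

@[simp]
lemma torsionByMap_apply (f : A →ₗ[R] B) (a : Submodule.torsionBy R A x) :
    (torsionByMap x f a : B) = f a := rfl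

lemma exists_torsionBy_extension {f : A →ₗ[R] B} {g : B →ₗ[R] C} (hf : Function.Injective f)
    (hfg : Function.Exact f g) (hg : Function.Surjective g) (hA : ∀ a : A, ∃ a', x • a' = a) :
    Function.Injective (torsionByMap x f) ∧
      Function.Exact (torsionByMap x f) (torsionByMap x g) ∧
      Function.Surjective (torsionByMap x g) := by
  refine ⟨fun a b h => Subtype.ext (hf (congrArg Subtype.val h)), fun b => ⟨fun hb => ?_, ?_⟩,
    fun c => ?_⟩
  · obtain ⟨a, ha⟩ := (hfg b).1 (congrArg Subtype.val hb)
    refine ⟨⟨a, hf ?_⟩, Subtype.ext ha⟩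
    change f (x • a) = f 0
    rw [map_smul, ha, map_zero]
    exact b.2
  · rintro ⟨a, rfl⟩
    exact Subtype.ext (hfg.apply_apply_eq_zero _)
  · obtain ⟨c, hc⟩ := c
    obtain ⟨b, rfl⟩ := hg c
    rw [Submodule.mem_torsionBy_iff, ← map_smul] at hc
    obtain ⟨a, ha⟩ := (hfg _).1 hc
    obtain ⟨a', rfl⟩ := hA a
    refine ⟨⟨b - f a', ?_⟩, Subtype.ext ?_⟩
    · rw [Submodule.mem_torsionBy_iff, smul_sub, ← ha, map_smul, sub_self]
    · simp [hfg.apply_apply_eq_zero]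

lemma IsExtension.torsionBy (h : IsExtension R A B C) (hA : ∀ a : A, ∃ a', x • a' = a) :
    IsExtension (R ⧸ Ideal.span {x}) (Submodule.torsionBy R A x) (Submodule.torsionBy R B x)
      (Submodule.torsionBy R C x) := by
  obtain ⟨f, g, hf, hfg, hg⟩ := h
  exact ⟨_, _, exists_torsionBy_extension x hf hfg hg hA⟩

lemma smul_eq_zero_of_quotient {J : Type u} [AddCommGroup J] [Module R J]
    [Module (R ⧸ Ideal.span {x}) J] [IsScalarTower R (R ⧸ Ideal.span {x}) J] (j : J) :
    x • j = 0 := by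
  rw [← one_smul (R ⧸ Ideal.span {x}) j, ← smul_assoc, Algebra.smul_def, mul_one,
    Ideal.Quotient.algebraMap_eq, Ideal.Quotient.eq_zero_iff_mem.2 (Ideal.mem_span_singleton_self x),
    zero_smul]

/-- Factor a map out of a module over the quotient ring through the submodule killed by `x`. -/
def toTorsionBy {J : Type u} [AddCommGroup J] [Module R J] [Module (R ⧸ Ideal.span {x}) J]
    [IsScalarTower R (R ⧸ Ideal.span {x}) J] (f : J →ₗ[R] A) :
    J →ₗ[R ⧸ Ideal.span {x}] Submodule.torsionBy R A x :=
  LinearMap.extendScalarsOfSurjective (S := R ⧸ Ideal.span {x}) Ideal.Quotient.mk_surjective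
    (f.codRestrict (Submodule.torsionBy R A x) fun j => by
      rw [Submodule.mem_torsionBy_iff, ← map_smul, smul_eq_zero_of_quotient, map_zero])

@[simp]
lemma toTorsionBy_apply {J : Type u} [AddCommGroup J] [Module R J] [Module (R ⧸ Ideal.span {x}) J]
    [IsScalarTower R (R ⧸ Ideal.span {x}) J] (f : J →ₗ[R] A) (j : J) :
    (toTorsionBy x f j : A) = f j := rfl

lemma injective_torsionBy {I : Type u} [AddCommGroup I] [Module R I]
    (hI : Injective (ModuleCat.of R I)) :
    Injective (ModuleCat.of (R ⧸ Ideal.span {x}) (Submodule.torsionBy R I x)) := by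
  rw [← Module.injective_iff_injective_object] at hI ⊢
  refine ⟨fun X Y _ _ _ _ f hf g => ?_⟩
  let := Module.compHom X (algebraMap R (R ⧸ Ideal.span {x}))
  let := Module.compHom Y (algebraMap R (R ⧸ Ideal.span {x}))
  have : IsScalarTower R (R ⧸ Ideal.span {x}) X := IsScalarTower.of_algebraMap_smul fun _ _ => rfl
  have : IsScalarTower R (R ⧸ Ideal.span {x}) Y := IsScalarTower.of_algebraMap_smul fun _ _ => rfl
  obtain ⟨h, hh⟩ := hI.out (f.restrictScalars R) hf
    ((Submodule.subtype _).comp (g.restrictScalars R))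
  exact ⟨toTorsionBy x h, fun y => Subtype.ext (hh y)⟩

lemma IsGorensteinInjective.exists_cocover (hA : IsGorensteinInjective R A) :
    ∃ B : ModuleCat.{u} R, IsGorensteinInjective R B ∧ InjectiveStep R A B := by
  obtain ⟨I, i, hI, hi⟩ := exists_injectiveStep_quotient (R := R) A
  exact ⟨ModuleCat.of R (I ⧸ LinearMap.range i), (isExtension_range hi).isGorensteinInjective_right
    hA (isGorensteinInjective_of_injective hI), I, i, _, hI, hi, LinearMap.exact_map_mkQ_range i,
    Submodule.mkQ_surjective _⟩

/-- Maps from the part of an injective module killed by `x` to a Gorenstein injective module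
extend to the whole injective module. -/
lemma IsGorensteinInjective.exists_extend_torsionBy (hx : x ∈ nonZeroDivisors R)
    (hA : IsGorensteinInjective R A) {E : Type u} [AddCommGroup E] [Module R E]
    (hE : Injective (ModuleCat.of R E)) (f : Submodule.torsionBy R E x →ₗ[R] A) :
    ∃ g : E →ₗ[R] A, ∀ e : Submodule.torsionBy R E x, g e = f e := by
  obtain ⟨B, hB, I, i, p, hI, hi, hip, hp⟩ := hA.exists_cocover
  obtain ⟨g, hg⟩ := ((Module.injective_iff_injective_object R I).2 hI).out
    (Submodule.torsionBy R E x).subtype Subtype.val_injective (i.comp f)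
  have hsurj : Function.Surjective (LinearMap.lsmul R E x) :=
    fun e => exists_smul_eq_of_injective x hx hE e
  have hker : LinearMap.ker (LinearMap.lsmul R E x) ≤ LinearMap.ker (p.comp g) := fun e he => by
    have := hg ⟨e, he⟩
    rw [LinearMap.mem_ker, LinearMap.comp_apply]
    simp only [Submodule.subtype_apply] at this
    rw [this]
    exact hip.apply_apply_eq_zero _
  let h : E →ₗ[R] B := (Submodule.liftQ _ _ hker).comp
    ((LinearMap.lsmul R E x).quotKerEquivOfSurjective hsurj).symm.toLinearMap
  have hh : ∀ e, h (x • e) = p (g e) := fun e => by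
    have : ((LinearMap.lsmul R E x).quotKerEquivOfSurjective hsurj).symm (x • e) =
        Submodule.Quotient.mk e := by
      rw [LinearEquiv.symm_apply_eq]
      rfl
    change Submodule.liftQ _ _ hker _ = _
    rw [LinearEquiv.coe_coe, this]
    rfl
  obtain ⟨h', hh'⟩ := exists_lift_of_subsingleton_ext hi hip hp (ModuleCat.of R E)
    (hA.isExtOrthogonal _ hE 0) h
  have hz : ∀ e, p ((g - x • h' : E →ₗ[R] I) e) = 0 := fun e => by
    have h1 : p (h' (x • e)) = h (x • e) := LinearMap.congr_fun hh' _
    rw [LinearMap.sub_apply, LinearMap.smul_apply, map_sub, ← map_smul, h1, hh, sub_self]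
  let k : E →ₗ[R] A := (LinearEquiv.ofInjective i hi).symm.toLinearMap.comp
    ((g - x • h').codRestrict (LinearMap.range i) fun e => (hip _).1 (hz e))
  refine ⟨k, fun e => hi ?_⟩
  have h1 : i (k e) = (g - x • h') e := by
    have h2 : LinearEquiv.ofInjective i hi (k e) =
      ((g - x • h').codRestrict (LinearMap.range i) fun e => (hip _).1 (hz e)) e := by simp [k]
    exact congrArg Subtype.val h2
  have h3 : x • (e : E) = 0 := e.2
  rw [h1, LinearMap.sub_apply, LinearMap.smul_apply, ← map_smul, h3, map_zero, sub_zero]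
  exact hg e

lemma IsGorensteinInjective.isExtOrthogonal_torsionBy (hx : x ∈ nonZeroDivisors R)
    (hA : IsGorensteinInjective R A) :
    IsExtOrthogonal (R ⧸ Ideal.span {x}) (Submodule.torsionBy R A x) := by
  intro J hJ n
  induction n generalizing A with
  | zero =>
    obtain ⟨B, hB, I, i, p, hI, hi, hip, hp⟩ := hA.exists_cocover
    obtain ⟨h1, h2, h3⟩ := exists_torsionBy_extension x hi hip hp (hA.exists_smul_eq x hx)
    refine subsingleton_ext_one_of_lift h1 h2 h3 J
      (subsingleton_ext_of_injective _ (injective_torsionBy x hI) J 0) fun φ => ?_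
    let := Module.compHom J (algebraMap R (R ⧸ Ideal.span {x}))
    have : IsScalarTower R (R ⧸ Ideal.span {x}) J :=
      IsScalarTower.of_algebraMap_smul fun _ _ => rfl
    obtain ⟨E, j, hE, hj⟩ := exists_injectiveStep_quotient (R := R) J
    obtain ⟨ρ, hρ⟩ := ((Module.injective_iff_injective_object _ J).2 hJ).out (toTorsionBy x j)
      (fun a b hab => hj (congrArg Subtype.val hab)) LinearMap.id
    obtain ⟨g, hg⟩ := hB.exists_extend_torsionBy x hx hE
      ((Submodule.subtype _).comp ((φ.comp ρ).restrictScalars R))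
    obtain ⟨k, hk⟩ := exists_lift_of_subsingleton_ext hi hip hp E (hA.isExtOrthogonal _ hE 0) g
    refine ⟨toTorsionBy x (k.comp j), ?_⟩
    ext a
    have h4 : p (k (j a)) = g (j a) := LinearMap.congr_fun hk _
    have h5 := hg (toTorsionBy x j a)
    rw [toTorsionBy_apply, ← h4] at h5
    refine h5.trans ?_
    change ((φ (ρ (toTorsionBy x j a))) : B) = φ a
    rw [hρ]
    rfl
  | succ n ih =>
    obtain ⟨B, hB, I, i, p, hI, hi, hip, hp⟩ := hA.exists_cocover
    obtain ⟨h1, h2, h3⟩ := exists_torsionBy_extension x hi hip hp (hA.exists_smul_eq x hx)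
    exact subsingleton_ext_left h1 h2 h3 J _ (ih hB)
      (subsingleton_ext_of_injective _ (injective_torsionBy x hI) J _)

lemma IsGorensteinInjective.torsionBy (hx : x ∈ nonZeroDivisors R)
    (hA : IsGorensteinInjective R A) :
    IsGorensteinInjective (R ⧸ Ideal.span {x}) (Submodule.torsionBy R A x) := by
  refine isGorensteinInjective_of_coind (fun B => ∃ G : ModuleCat.{u} R,
    IsGorensteinInjective R G ∧ B = ModuleCat.of _ (Submodule.torsionBy R G x)) ?_
    ⟨ModuleCat.of R A, hA, rfl⟩
  rintro _ ⟨G, hG, rfl⟩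
  obtain ⟨G', hG', I, i, p, hI, hi, hip, hp⟩ := hG.exists_cover
  exact ⟨hG.isExtOrthogonal_torsionBy x hx, _, ⟨G', hG', rfl⟩, _, _, _, injective_torsionBy x hI,
    exists_torsionBy_extension x hi hip hp (hG'.exists_smul_eq x hx)⟩

lemma GidLE.torsionBy (hx : x ∈ nonZeroDivisors R) {n : ℕ} (hA : GidLE R n A)
    (hxA : ∀ a : A, ∃ a', x • a' = a) :
    GidLE (R ⧸ Ideal.span {x}) n (Submodule.torsionBy R A x) := by
  induction n generalizing A with
  | zero => exact IsGorensteinInjective.torsionBy x hx hA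
  | succ n ih =>
    obtain ⟨G, N, hG, hN, h⟩ := hA
    refine ⟨ModuleCat.of _ (Submodule.torsionBy R G x), ModuleCat.of _ (Submodule.torsionBy R N x),
      hG.torsionBy x hx, ih hN fun y => ?_, h.torsionBy x hxA⟩
    obtain ⟨f, g, hf, hfg, hg⟩ := h
    obtain ⟨y, rfl⟩ := hg y
    obtain ⟨z, rfl⟩ := hG.exists_smul_eq x hx y
    exact ⟨g z, (map_smul g x z).symm⟩

/-- The connecting homomorphism of the snake lemma for multiplication by `x`. -/
lemma exists_snake {f : A →ₗ[R] B} {g : B →ₗ[R] C} (hf : Function.Injective f)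
    (hfg : Function.Exact f g) (hg : Function.Surjective g) (hB : ∀ b : B, ∃ b', x • b' = b) :
    ∃ δ : Submodule.torsionBy R C x →ₗ[R ⧸ Ideal.span {x}]
        A ⧸ (Ideal.span {x} • ⊤ : Submodule R A),
      Function.Exact (torsionByMap x g) δ ∧ Function.Surjective δ := by
  let W : Submodule R B := LinearMap.ker (x • g)
  let π : W →ₗ[R] Submodule.torsionBy R C x := (g.comp W.subtype).codRestrict _ fun w => w.2
  have hπ : Function.Surjective π := by
    rintro ⟨c, hc⟩
    obtain ⟨b, rfl⟩ := hg c
    exact ⟨⟨b, hc⟩, rfl⟩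
  let θ₀ : W →ₗ[R] A := (LinearEquiv.ofInjective f hf).symm.toLinearMap.comp
    ((x • W.subtype).codRestrict (LinearMap.range f) fun w => (hfg _).1 (by
      have : x • g w = 0 := w.2
      simpa using this))
  have hθ₀ : ∀ w, f (θ₀ w) = x • (w : B) := fun w => by
    have h2 : LinearEquiv.ofInjective f hf (θ₀ w) =
      ((x • W.subtype).codRestrict (LinearMap.range f) fun w => (hfg _).1 (by
      have : x • g w = 0 := w.2
      simpa using this)) w := by simp [θ₀]
    exact congrArg Subtype.val h2
  let P : Submodule R A := Ideal.span {x} • ⊤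
  have hP : ∀ a, a ∈ P ↔ ∃ a', x • a' = a := fun a => by
    simp [P, Submodule.ideal_span_singleton_smul, Submodule.mem_smul_pointwise_iff_exists]
  have hkey : ∀ w : W, P.mkQ (θ₀ w) = 0 ↔ ∃ b : B, x • b = 0 ∧ g b = g w := fun w => by
    rw [Submodule.mkQ_apply, Submodule.Quotient.mk_eq_zero, hP]
    constructor
    · rintro ⟨a, ha⟩
      refine ⟨w - f a, ?_, by simp [hfg.apply_apply_eq_zero]⟩
      rw [smul_sub, ← map_smul, ha, hθ₀, sub_self]
    · rintro ⟨b, hb, hbw⟩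
      obtain ⟨a, ha⟩ := (hfg (w - b)).1 (by rw [map_sub, hbw, sub_self])
      refine ⟨a, hf ?_⟩
      rw [map_smul, ha, hθ₀, smul_sub, hb, sub_zero]
  have hker : LinearMap.ker π ≤ LinearMap.ker (P.mkQ.comp θ₀) := fun w hw =>
    (hkey w).2 ⟨0, smul_zero _, by
      rw [map_zero]
      exact (congrArg Subtype.val hw).symm⟩
  let δ₀ : Submodule.torsionBy R C x →ₗ[R] A ⧸ P := (Submodule.liftQ _ _ hker).comp
    (π.quotKerEquivOfSurjective hπ).symm.toLinearMap
  have hδ₀ : ∀ w, δ₀ (π w) = P.mkQ (θ₀ w) := fun w => by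
    have : (π.quotKerEquivOfSurjective hπ).symm (π w) = Submodule.Quotient.mk w := by
      rw [LinearEquiv.symm_apply_eq]
      rfl
    change Submodule.liftQ _ _ hker _ = _
    rw [LinearEquiv.coe_coe, this]
    rfl
  refine ⟨LinearMap.extendScalarsOfSurjective (S := R ⧸ Ideal.span {x})
    Ideal.Quotient.mk_surjective δ₀, fun c => ?_, fun a => ?_⟩
  · obtain ⟨w, rfl⟩ := hπ c
    refine Iff.trans (b := P.mkQ (θ₀ w) = 0) (by rw [← hδ₀]; rfl) ((hkey w).trans ?_)
    constructor
    · rintro ⟨b, hb, hbw⟩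
      exact ⟨⟨b, hb⟩, Subtype.ext hbw⟩
    · rintro ⟨b, hb⟩
      exact ⟨b, b.2, congrArg Subtype.val hb⟩
  · obtain ⟨a, rfl⟩ := Submodule.mkQ_surjective _ a
    obtain ⟨b, hb⟩ := hB (f a)
    have hbW : b ∈ W := by
      change x • g b = 0
      rw [← map_smul, hb, hfg.apply_apply_eq_zero]
    refine ⟨π ⟨b, hbW⟩, (hδ₀ _).trans (congrArg P.mkQ (hf ?_))⟩
    rw [hθ₀, hb]

lemma exists_smul_eq_of_exact (hx : x ∈ nonZeroDivisors R) {g : A →ₗ[R] B}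
    (hA : IsGorensteinInjective R A) (hg : Function.Surjective g) (y : B) : ∃ z, x • z = y := by
  obtain ⟨y, rfl⟩ := hg y
  obtain ⟨z, rfl⟩ := hA.exists_smul_eq x hx y
  exact ⟨g z, (map_smul g x z).symm⟩

lemma GidLE.quotient (hx : x ∈ nonZeroDivisors R) (hxA : IsSMulRegular A x) {n : ℕ}
    (hA : GidLE R (n + 1) A) :
    GidLE (R ⧸ Ideal.span {x}) n (A ⧸ (Ideal.span {x} • ⊤ : Submodule R A)) := by
  obtain ⟨G, N, hG, hN, f, g, hf, hfg, hg⟩ := hA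
  obtain ⟨δ, h1, h2⟩ := exists_snake x hf hfg hg (hG.exists_smul_eq x hx)
  refine GidLE.of_extension ⟨torsionByMap x g, δ, ?_, h1, h2⟩ (hG.torsionBy x hx)
    (hN.torsionBy x hx (exists_smul_eq_of_exact x hx hG hg))
  rw [injective_iff_map_eq_zero]
  intro b hb
  obtain ⟨a, ha⟩ := (hfg b).1 (congrArg Subtype.val hb)
  have hb' : x • (b : G) = 0 := b.2
  rw [← ha, ← map_smul, map_eq_zero_iff f hf] at hb'
  have : a = 0 := hxA (by simpa using hb')
  exact Subtype.ext (by rw [← ha, this, map_zero]; rfl)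

end TorsionReduction

section LowerBound

open RingTheory.Sequence

lemma isWeaklyRegular_quotient_of_cons {R : Type u} [CommRing R] {x : R} {rs : List R}
    (h : IsWeaklyRegular R (x :: rs)) :
    IsWeaklyRegular (R ⧸ Ideal.span {x}) (rs.map (Ideal.Quotient.mk (Ideal.span {x}))) := by
  have h1 := ((isWeaklyRegular_cons_iff R x rs).1 h).2
  have e : QuotSMulTop x R ≃ₗ[R] R ⧸ Ideal.span {x} := Submodule.quotEquivOfEq _ _ (by
    rw [← Submodule.ideal_span_singleton_smul, smul_eq_mul, Ideal.mul_top])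
  exact (isWeaklyRegular_map_algebraMap_iff (R ⧸ Ideal.span {x}) (R ⧸ Ideal.span {x}) rs).2
    ((e.isWeaklyRegular_congr rs).1 h1)

lemma ofList_cons_smul_eq_top {R : Type u} [CommRing R] {x : R} {rs : List R}
    {M : Type u} [AddCommGroup M] [Module R M]
    (h : Ideal.ofList (rs.map (Ideal.Quotient.mk (Ideal.span {x}))) • ⊤ =
      (⊤ : Submodule (R ⧸ Ideal.span {x}) (M ⧸ (Ideal.span {x} • ⊤ : Submodule R M)))) :
    Ideal.ofList (x :: rs) • ⊤ = (⊤ : Submodule R M) := by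
  rw [← Submodule.restrictScalars_inj R (R ⧸ _), ← Ideal.map_ofList,
    ← Ideal.Quotient.algebraMap_eq, Ideal.smul_restrictScalars, Submodule.restrictScalars_top,
    ← Submodule.range_mkQ (Ideal.span {x} • ⊤ : Submodule R M), LinearMap.range_eq_map,
    ← Submodule.map_smul''] at h
  rw [Ideal.ofList_cons, Submodule.sup_smul, eq_top_iff]
  intro m _
  obtain ⟨w, hw, hw'⟩ : (Ideal.span {x} • ⊤ : Submodule R M).mkQ m ∈
    Submodule.map (Ideal.span {x} • ⊤ : Submodule R M).mkQ (Ideal.ofList rs • ⊤) := by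
    rw [h]; exact ⟨m, trivial, rfl⟩
  have h2 : m - w ∈ (Ideal.span {x} • ⊤ : Submodule R M) :=
    (Submodule.Quotient.eq _).1 hw'.symm
  rw [← sub_add_cancel m w]
  exact Submodule.add_mem_sup h2 hw

/-- The length of a weakly regular sequence on the ring bounds the Gorenstein injective dimension
of any module with nonzero reduction from below. -/
theorem GidLE.length_le {R : Type u} [CommRing R] {rs : List R} (hrs : IsWeaklyRegular R rs)
    {M : Type u} [AddCommGroup M] [Module R M] {n : ℕ} (hM : GidLE R n M)
    (hne : Ideal.ofList rs • ⊤ ≠ (⊤ : Submodule R M)) : rs.length ≤ n := by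
  induction n generalizing R M with
  | zero =>
    cases rs with
    | nil => exact le_rfl
    | cons x rs =>
      refine absurd ?_ hne
      have hx : x ∈ nonZeroDivisors R :=
        isRegular_iff_mem_nonZeroDivisors.1 (isLeftRegular_iff_isRegular.1
          ((isWeaklyRegular_cons_iff R x rs).1 hrs).1)
      rw [eq_top_iff]
      intro m _
      obtain ⟨m, rfl⟩ := IsGorensteinInjective.exists_smul_eq x hx hM m
      exact Submodule.smul_mem_smul (Ideal.subset_span (by simp)) trivial
  | succ n ih =>
    cases rs with
    | nil => exact Nat.zero_le _
    | cons x rs =>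
      have hx : x ∈ nonZeroDivisors R :=
        isRegular_iff_mem_nonZeroDivisors.1 (isLeftRegular_iff_isRegular.1
          ((isWeaklyRegular_cons_iff R x rs).1 hrs).1)
      obtain ⟨G, N, hG, hN, f, g, hf, hfg, hg⟩ := hM
      obtain ⟨δ, -, hδ⟩ := exists_snake x hf hfg hg (hG.exists_smul_eq x hx)
      have := ih (isWeaklyRegular_quotient_of_cons hrs)
        (hN.torsionBy x hx (exists_smul_eq_of_exact x hx hG hg)) fun h => hne <| by
          refine ofList_cons_smul_eq_top ?_
          rw [← LinearMap.range_eq_top.2 hδ, LinearMap.range_eq_map, ← Submodule.map_smul'', h]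
      simpa using this

end LowerBound

section UpperBound

open Abelian RingTheory.Sequence

variable {R : Type u} [CommRing R]

lemma exists_shortExact_of_injective (A : Type u) [AddCommGroup A] [Module R A] :
    ∃ (I C : ModuleCat.{u} R) (f : A →ₗ[R] I) (g : I →ₗ[R] C), Injective I ∧
      Function.Injective f ∧ Function.Exact f g ∧ Function.Surjective g := by
  obtain ⟨I, i, hI, hi⟩ := exists_injectiveStep_quotient (R := R) A
  exact ⟨I, ModuleCat.of R (I ⧸ LinearMap.range i), i, _, hI, hi, LinearMap.exact_map_mkQ_range i,
    Submodule.mkQ_surjective _⟩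

lemma hasInjectiveDimensionLT_iff_of_exact {A I C : Type u} [AddCommGroup A] [Module R A]
    [AddCommGroup I] [Module R I] [AddCommGroup C] [Module R C] {f : A →ₗ[R] I} {g : I →ₗ[R] C}
    (hI : Injective (ModuleCat.of R I)) (hf : Function.Injective f) (hfg : Function.Exact f g)
    (hg : Function.Surjective g) (n : ℕ) :
    HasInjectiveDimensionLT (ModuleCat.of R C) (n + 1) ↔
      HasInjectiveDimensionLT (ModuleCat.of R A) (n + 2) := by
  obtain ⟨w, hS⟩ := exists_shortExact_of_exact hf hfg hg
  exact hS.hasInjectiveDimensionLT_X₃_iff n hI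

lemma GidLE.of_hasInjectiveDimensionLT {n : ℕ} {A : Type u} [AddCommGroup A] [Module R A]
    (h : HasInjectiveDimensionLT (ModuleCat.of R A) (n + 1)) : GidLE R n A := by
  induction n generalizing A with
  | zero =>
    exact isGorensteinInjective_of_injective (injective_iff_hasInjectiveDimensionLT_one.2 h)
  | succ n ih =>
    obtain ⟨I, C, f, g, hI, hf, hfg, hg⟩ := exists_shortExact_of_injective (R := R) A
    exact ⟨I, C, isGorensteinInjective_of_injective hI,
      ih ((hasInjectiveDimensionLT_iff_of_exact hI hf hfg hg n).2 h), f, g, hf, hfg, hg⟩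

/-- A module of finite Gorenstein injective dimension is a quotient of a module of finite
injective dimension by a Gorenstein injective module. -/
lemma GidLE.exists_hasInjectiveDimensionLT {n : ℕ} {M : Type u} [AddCommGroup M] [Module R M]
    (h : GidLE R n M) :
    ∃ H L : ModuleCat.{u} R, IsGorensteinInjective R H ∧ HasInjectiveDimensionLT L (n + 1) ∧
      IsExtension R H L M := by
  induction n generalizing M with
  | zero =>
    obtain ⟨I, p, hI, hp, hpk⟩ := IsGorensteinInjective.exists_surjective h
    exact ⟨ModuleCat.of R (LinearMap.ker p), I, hpk, injective_iff_hasInjectiveDimensionLT_one.1 hI, isExtension_ker hp⟩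
  | succ n ih =>
    obtain ⟨G, N, hG, hN, f, g, hf, hfg, hg⟩ := h
    obtain ⟨H', L', hH', hL', a, b, ha, hab, hb⟩ := ih hN
    let P : Submodule R (G × L') :=
      LinearMap.ker (g.comp (LinearMap.fst R G L') - b.comp (LinearMap.snd R G L'))
    have hP : ∀ w : G × L', w ∈ P ↔ g w.1 = b w.2 := fun w => by
      simp [P, sub_eq_zero]
    have hPG : IsExtension R H' P G := by
      refine ⟨((LinearMap.inr R G L').comp a).codRestrict P fun z => ?_,
        (LinearMap.fst R G L').comp P.subtype, fun y z hyz => ?_, fun w => ?_, fun y => ?_⟩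
      · rw [hP]
        simp [hab.apply_apply_eq_zero]
      · exact ha (congrArg (fun w => w.1.2) hyz)
      · constructor
        · intro hw
          have hw' : w.1.1 = 0 := hw
          have h1 := (hP w.1).1 w.2
          rw [hw', map_zero] at h1
          obtain ⟨z, hz⟩ := (hab _).1 h1.symm
          exact ⟨z, Subtype.ext (Prod.ext hw'.symm hz)⟩
        · rintro ⟨z, rfl⟩
          rfl
      · obtain ⟨l, hl⟩ := hb (g y)
        exact ⟨⟨(y, l), (hP _).2 hl.symm⟩, rfl⟩
    let t : P →ₗ[R] L' := (LinearMap.snd R G L').comp P.subtype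
    have ht : Function.Surjective t := fun l => by
      obtain ⟨y, hy⟩ := hg (b l)
      exact ⟨⟨(y, l), (hP _).2 hy⟩, rfl⟩
    let j : M →ₗ[R] LinearMap.ker t :=
      (((LinearMap.inl R G L').comp f).codRestrict P fun m => by
        rw [hP]
        simp [hfg.apply_apply_eq_zero]).codRestrict _ fun m => rfl
    have hj : Function.Bijective j := by
      constructor
      · intro m m' hm
        exact hf (congrArg (fun w => w.1.1.1) hm)
      · rintro ⟨w, hw⟩
        have hw' : w.1.2 = 0 := hw
        have h1 := (hP w.1).1 w.2
        rw [hw', map_zero] at h1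
        obtain ⟨m, hm⟩ := (hfg _).1 h1
        exact ⟨m, Subtype.ext (Subtype.ext (Prod.ext hm hw'.symm))⟩
    obtain ⟨I, q, hI, hq, hqk⟩ := (hPG.isGorensteinInjective hH' hG).exists_surjective
    exact ⟨ModuleCat.of R (LinearMap.ker q), ModuleCat.of R (LinearMap.ker (t.comp q)), hqk,
      (hasInjectiveDimensionLT_iff_of_exact hI Subtype.val_injective
        (LinearMap.exact_subtype_ker_map (t.comp q)) (ht.comp hq) n).1 hL',
      (isExtension_ker_comp hq t).congr_right (LinearEquiv.ofBijective j hj).symm⟩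

lemma injective_of_subsingleton_ext_finite {L : ModuleCat.{u} R}
    (h : ∀ N : ModuleCat.{u} R, Module.Finite R N → Subsingleton (Ext N L 1)) : Injective L := by
  refine (Module.injective_iff_injective_object R L).1 (Module.Baer.injective fun I φ => ?_)
  obtain ⟨w, hS⟩ := exists_shortExact_of_exact (f := I.subtype) (g := I.mkQ)
    Subtype.val_injective (LinearMap.exact_subtype_mkQ I) (Submodule.mkQ_surjective I)
  obtain ⟨z, hz⟩ := Ext.contravariant_sequence_exact₁ hS L
    (Ext.mk₀ (ModuleCat.ofHom (X := I) (Y := L) φ)) (add_zero 1)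
    ((h (ModuleCat.of R (R ⧸ I)) inferInstance).elim _ _)
  obtain ⟨k, rfl⟩ := Ext.homEquiv₀.symm.surjective z
  simp only [Ext.homEquiv₀_symm_apply, Ext.mk₀_comp_mk₀] at hz
  have := congrArg ModuleCat.Hom.hom (Ext.homEquiv₀.symm.injective hz)
  exact ⟨k.hom, fun y hy => LinearMap.congr_fun this ⟨y, hy⟩⟩

lemma hasInjectiveDimensionLT_of_subsingleton_ext_finite {L : Type u} [AddCommGroup L]
    [Module R L] {n : ℕ} (h : ∀ N : ModuleCat.{u} R, Module.Finite R N →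
      Subsingleton (Ext N (ModuleCat.of R L) (n + 1))) :
    HasInjectiveDimensionLT (ModuleCat.of R L) (n + 1) := by
  induction n generalizing L with
  | zero =>
    exact injective_iff_hasInjectiveDimensionLT_one.1 (injective_of_subsingleton_ext_finite h)
  | succ n ih =>
    obtain ⟨I, C, f, g, hI, hf, hfg, hg⟩ := exists_shortExact_of_injective (R := R) L
    refine (hasInjectiveDimensionLT_iff_of_exact hI hf hfg hg n).1 (ih fun N hN => ?_)
    exact subsingleton_ext_right hf hfg hg N _ (subsingleton_ext_of_injective I hI N n) (h N hN)

/-- Every prime cyclic module embeds into the quotient of `R` by a regular sequence of length at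
most `r`. -/
def PrimesEmbed (R : Type u) [CommRing R] [IsLocalRing R] (r : ℕ) : Prop :=
  ∀ p : Ideal R, p.IsPrime → ∃ rs : List R, IsWeaklyRegular R rs ∧
    (∀ y ∈ rs, y ∈ maximalIdeal R) ∧ rs.length ≤ r ∧
    ∃ f : (R ⧸ p) →ₗ[R] R ⧸ (Ideal.ofList rs • ⊤ : Submodule R R), Function.Injective f

variable [IsNoetherianRing R] [IsLocalRing R]

lemma subsingleton_ext_quotient_ofList {rs : List R} (hrs : IsWeaklyRegular R rs)
    (hm : ∀ y ∈ rs, y ∈ maximalIdeal R) (Y : ModuleCat.{u} R) {i : ℕ} (hi : rs.length < i) :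
    Subsingleton (Ext (ModuleCat.of R (R ⧸ (Ideal.ofList rs • ⊤ : Submodule R R))) Y i) := by
  have h := ModuleCat.projectiveDimension_quotient_eq_add_length_of_isWeaklyRegular
    (ModuleCat.of R R) rs hrs hm
  have h' : projectiveDimension (ModuleCat.of R R) ≤ (0 : ℕ) := by
    rw [projectiveDimension_le_iff]
    exact projective_iff_hasProjectiveDimensionLT_one.1
      ((IsProjective.iff_projective (R := R) R).1 inferInstance)
  have h2 : projectiveDimension (ModuleCat.of R (R ⧸ (Ideal.ofList rs • ⊤ : Submodule R R))) ≤
      rs.length := by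
    refine h.le.trans ?_
    simpa using add_le_add_left h' (rs.length : WithBot ℕ∞)
  rw [projectiveDimension_le_iff] at h2
  exact HasProjectiveDimensionLT.subsingleton _ (rs.length + 1) i hi Y

lemma HasInjectiveDimensionLT.descend {r : ℕ} (hD : PrimesEmbed R r) {L : Type u}
    [AddCommGroup L] [Module R L] {n : ℕ} (hn : r ≤ n)
    (hL : HasInjectiveDimensionLT (ModuleCat.of R L) (n + 2)) :
    HasInjectiveDimensionLT (ModuleCat.of R L) (n + 1) := by
  refine hasInjectiveDimensionLT_of_subsingleton_ext_finite fun N hN => ?_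
  have key := IsNoetherianRing.induction_on_isQuotientEquivQuotientPrime R (M := N) hN
    (motive := fun N _ _ _ => Subsingleton (Ext (ModuleCat.of R N) (ModuleCat.of R L) (n + 1)))
  refine key (fun N _ _ _ _ => ?_) (fun N _ _ _ p e => ?_)
    fun N₁ _ _ _ N₂ _ _ _ N₃ _ _ _ f g hf hg hfg h1 h3 =>
      subsingleton_ext_of_middle hf hfg hg _ _ h1 h3
  · refine subsingleton_of_forall_eq 0 fun y => ?_
    rw [← y.mk₀_id_comp, (ModuleCat.isZero_of_subsingleton (ModuleCat.of R N)).eq_of_src (𝟙 _) 0,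
      Ext.mk₀_zero, Ext.zero_comp]
  · obtain ⟨rs, hrs, hm, hlen, f, hf⟩ := hD p.1 p.2
    exact subsingleton_ext_of_left (f := f.comp e.toLinearMap) (hf.comp e.injective)
      (LinearMap.exact_map_mkQ_range _) (Submodule.mkQ_surjective _) _ _
      (subsingleton_ext_quotient_ofList hrs hm _ (by lia))
      (HasInjectiveDimensionLT.subsingleton _ (n + 2) (n + 2) le_rfl _)

/-- A local ring all of whose prime cyclic modules embed into quotients by regular sequences of
length at most `r` has finitistic Gorenstein injective dimension at most `r`. -/
theorem GidLE.le_of_primesEmbed {r : ℕ} (hD : PrimesEmbed R r) {M : Type u} [AddCommGroup M]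
    [Module R M] {n : ℕ} (h : GidLE R n M) : GidLE R r M := by
  obtain ⟨H, L, hH, hL, hext⟩ := h.exists_hasInjectiveDimensionLT
  refine GidLE.of_extension hext hH (GidLE.of_hasInjectiveDimensionLT ?_)
  have hL' : ∀ k, HasInjectiveDimensionLT (ModuleCat.of R L) (r + k + 1) →
      HasInjectiveDimensionLT (ModuleCat.of R L) (r + 1) := fun k => by
    induction k with
    | zero => exact id
    | succ k ih => exact fun h => ih (HasInjectiveDimensionLT.descend hD (Nat.le_add_right r k) h)
  exact hL' n (hasInjectiveDimensionLT_of_ge _ (n + 1) _ (by lia))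

end UpperBound

section Depth

open RingTheory.Sequence Abelian
open scoped Pointwise

variable {R : Type u} [CommRing R] [IsLocalRing R]

/-- `DepthGE R N k`: the groups `Extⁱ(R/𝔪, N)` vanish for `i < k`. -/
def DepthGE (R : Type u) [CommRing R] [IsLocalRing R] (N : Type u) [AddCommGroup N] [Module R N]
    (k : ℕ) : Prop :=
  ∀ i < k, Subsingleton (Ext (ModuleCat.of R (R ⧸ maximalIdeal R)) (ModuleCat.of R N) i)

lemma DepthGE.congr {N N' : Type u} [AddCommGroup N] [Module R N] [AddCommGroup N'] [Module R N']
    {k : ℕ} (e : N ≃ₗ[R] N') (h : DepthGE R N k) : DepthGE R N' k := fun i hi =>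
  ((((extFunctorObj (ModuleCat.of R (R ⧸ maximalIdeal R)) i).mapIso
    e.toModuleIso).addCommGroupIsoToAddEquiv).symm.toEquiv.subsingleton_congr).2 (h i hi)

lemma support_quotient_maximalIdeal :
    Module.support R (R ⧸ maximalIdeal R) = PrimeSpectrum.zeroLocus (maximalIdeal R) := by
  rw [Module.support_eq_zeroLocus, Ideal.annihilator_quotient]

lemma maximalIdeal_smul_top_lt (N : Type u) [AddCommGroup N] [Module R N] [Module.Finite R N]
    [Nontrivial N] : maximalIdeal R • (⊤ : Submodule R N) < ⊤ :=
  lt_top_iff_ne_top.2 fun h => top_ne_bot (α := Submodule R N) <|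
    Submodule.eq_bot_of_le_smul_of_le_jacobson_bot _ _ Module.Finite.fg_top h.ge
      (maximalIdeal_le_jacobson _)

lemma DepthGE.quotSMulTop {N : Type u} [AddCommGroup N] [Module R N] {k : ℕ} {x : R}
    (hx : IsSMulRegular N x) (h : DepthGE R N (k + 1)) : DepthGE R (QuotSMulTop x N) k := by
  intro i hi
  have zero1 := AddCommGrpCat.isZero_of_iff_subsingleton.mpr (h i (by omega))
  have zero2 := AddCommGrpCat.isZero_of_iff_subsingleton.mpr (h (i + 1) (by omega))
  have hx' : IsSMulRegular (ModuleCat.of R N) x := hx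
  exact AddCommGrpCat.subsingleton_of_isZero <| ShortComplex.Exact.isZero_of_both_zeros
    ((Ext.covariant_sequence_exact₃' (ModuleCat.of R (R ⧸ maximalIdeal R))
      hx'.smulShortComplex_shortExact) i (i + 1) rfl)
    (zero1.eq_zero_of_src _) (zero2.eq_zero_of_tgt _)

lemma DepthGE.quotient_ofList {N : Type u} [AddCommGroup N] [Module R N] {k : ℕ} {rs : List R}
    (hrs : IsWeaklyRegular N rs) (h : DepthGE R N (k + rs.length)) :
    DepthGE R (N ⧸ (Ideal.ofList rs • ⊤ : Submodule R N)) k := by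
  induction rs generalizing N with
  | nil =>
    refine h.congr (Submodule.quotEquivOfEqBot _ ?_).symm
    rw [Ideal.ofList_nil, Submodule.bot_smul]
  | cons x rs ih =>
    rw [isWeaklyRegular_cons_iff] at hrs
    exact (ih hrs.2 (h.quotSMulTop hrs.1)).congr
      (Submodule.quotOfListConsSMulTopEquivQuotSMulTopInner N x rs).symm

lemma length_le_ringDepth {rs : List R} (hm : ∀ y ∈ rs, y ∈ maximalIdeal R)
    (hrs : IsWeaklyRegular R rs) : (rs.length : ℕ∞) ≤ ringDepth R :=
  le_sSup ⟨rs, rfl, hm,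
    (IsLocalRing.isRegular_iff_isWeaklyRegular_of_subset_maximalIdeal hm).2 hrs⟩

lemma ringKrullDim_quotient_succ_le_of_lt {A : Type u} [CommRing A] {p q : Ideal A} [p.IsPrime]
    (h : p < q) : ringKrullDim (A ⧸ q) + 1 ≤ ringKrullDim (A ⧸ p) := by
  obtain ⟨y, hyq, hyp⟩ := SetLike.exists_of_lt h
  refine le_trans ?_ (ringKrullDim_quotient_succ_le_of_nonZeroDivisor
    (r := Ideal.Quotient.mk p y) (mem_nonZeroDivisors_of_ne_zero
      (mt Ideal.Quotient.eq_zero_iff_mem.1 hyp)))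
  refine add_le_add_left (ringKrullDim_le_of_surjective (Ideal.Quotient.lift _
    (Ideal.Quotient.factor h.le) fun a ha => ?_) ?_) 1
  · obtain ⟨b, rfl⟩ := Ideal.mem_span_singleton'.1 ha
    rw [map_mul, Ideal.Quotient.factor_mk, Ideal.Quotient.eq_zero_iff_mem.2 hyq, mul_zero]
  · exact Ideal.Quotient.lift_surjective_of_surjective _ _ (Ideal.Quotient.factor_surjective h.le)

variable [IsNoetherianRing R]

lemma depthGE_of_isRegular {N : Type u} [AddCommGroup N] [Module R N] [Module.Finite R N]
    {rs : List R} (hm : ∀ y ∈ rs, y ∈ maximalIdeal R) (hrs : IsRegular N rs) :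
    DepthGE R N rs.length := by
  have := hrs.nontrivial
  exact ModuleCat.subsingleton_ext_of_exists_isRegular (maximalIdeal R) _
    support_quotient_maximalIdeal.le (ModuleCat.of R N) (maximalIdeal_smul_top_lt N) rs hm hrs

lemma DepthGE.exists_isRegular {N : Type u} [AddCommGroup N] [Module R N] [Module.Finite R N]
    [Nontrivial N] {k : ℕ} (h : DepthGE R N k) :
    ∃ rs : List R, rs.length = k ∧ (∀ y ∈ rs, y ∈ maximalIdeal R) ∧ IsRegular N rs :=
  ModuleCat.exists_isRegular_of_exists_subsingleton_ext (maximalIdeal R) k (ModuleCat.of R N)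
    (maximalIdeal_smul_top_lt N) _ support_quotient_maximalIdeal h

lemma IsAssociatedPrime.exists_quotSMulTop {N : Type u} [AddCommGroup N] [Module R N]
    [Module.Finite R N] {q : Ideal R} (hq : IsAssociatedPrime q N) {y : R}
    (hy : y ∈ maximalIdeal R) (hyN : IsSMulRegular N y) :
    ∃ q' : Ideal R, IsAssociatedPrime q' (QuotSMulTop y N) ∧ q ≤ q' ∧ y ∈ q' := by
  obtain ⟨hq', n₀, hn₀⟩ := isAssociatedPrime_iff.1 hq
  have hn₀' : n₀ ≠ 0 := by
    rintro rfl
    exact hq'.ne_top (hn₀.trans (by ext; simp [Submodule.mem_colon_singleton]))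
  obtain ⟨n, hn, hny⟩ : ∃ n ∈ Submodule.torsionBySet R N (q : Set R),
      n ∉ y • (⊤ : Submodule R N) := by
    by_contra! hcon
    have h0 : Submodule.torsionBySet R N (q : Set R) = ⊥ := by
      refine Submodule.eq_bot_of_le_smul_of_le_jacobson_bot (maximalIdeal R) _
        (IsNoetherian.noetherian _) (fun n hn => ?_) (maximalIdeal_le_jacobson _)
      obtain ⟨n', -, rfl⟩ := (Submodule.mem_smul_pointwise_iff_exists _ _ _).1 (hcon n hn)
      refine Submodule.smul_mem_smul hy ((Submodule.mem_torsionBySet_iff _ _).2 fun a => hyN ?_)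
      have := (Submodule.mem_torsionBySet_iff _ _).1 hn a
      simpa [smul_comm y] using this
    refine hn₀' ((Submodule.mem_bot R).1 (h0 ▸ (Submodule.mem_torsionBySet_iff _ _).2 fun a => ?_))
    have := a.2
    simpa [hn₀, Submodule.mem_colon_singleton] using this
  obtain ⟨q', hq', hle⟩ := exists_le_isAssociatedPrime_of_isNoetherianRing R
    (Submodule.Quotient.mk n : QuotSMulTop y N)
    (fun h => hny ((Submodule.Quotient.mk_eq_zero _).1 h))
  refine ⟨q', hq', fun a ha => hle ?_, hle ?_⟩
  · rw [Submodule.mem_colon_singleton, Submodule.mem_bot, ← Submodule.Quotient.mk_smul,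
      (Submodule.mem_torsionBySet_iff _ _).1 hn ⟨a, ha⟩, Submodule.Quotient.mk_zero]
  · rw [Submodule.mem_colon_singleton, Submodule.mem_bot, ← Submodule.Quotient.mk_smul,
      Submodule.Quotient.mk_eq_zero]
    exact Submodule.smul_mem_pointwise_smul _ _ _ trivial

lemma DepthGE.le_ringKrullDim_quotient {N : Type u} [AddCommGroup N] [Module R N]
    [Module.Finite R N] {k : ℕ} (h : DepthGE R N k) {q : Ideal R} (hq : IsAssociatedPrime q N) :
    (k : WithBot ℕ∞) ≤ ringKrullDim (R ⧸ q) := by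
  have := hq.isPrime
  induction k generalizing N q with
  | zero => exact ringKrullDim_nonneg_of_nontrivial
  | succ k ih =>
    have h0 := h 0 k.succ_pos
    have : Subsingleton ((R ⧸ maximalIdeal R) →ₗ[R] N) :=
      ((Ext.addEquiv₀ (X := ModuleCat.of R (R ⧸ maximalIdeal R)) (Y := ModuleCat.of R N)).trans
        ModuleCat.homAddEquiv).symm.toEquiv.subsingleton
    obtain ⟨y, hy, hyN⟩ := IsSMulRegular.subsingleton_linearMap_iff.1 this
    rw [Ideal.annihilator_quotient] at hy
    obtain ⟨q', hq', hle, hyq'⟩ := IsAssociatedPrime.exists_quotSMulTop hq hy hyN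
    have hyq : y ∉ q := fun hyq => by
      have := biUnion_associatedPrimes_eq_compl_regular R N
      exact this.le (Set.mem_biUnion hq hyq) hyN
    have hlt : q < q' := lt_of_le_of_ne hle fun e => hyq (e ▸ hyq')
    have hk := ih (h.quotSMulTop hyN) hq' hq'.isPrime
    refine le_trans ?_ (ringKrullDim_quotient_succ_le_of_lt hlt)
    push_cast
    exact add_le_add_left hk 1

lemma exists_length_eq_ringDepth (R : Type u) [CommRing R] [IsNoetherianRing R] [IsLocalRing R] :
    ∃ rs : List R, ringDepth R = rs.length ∧ (∀ y ∈ rs, y ∈ maximalIdeal R) ∧ IsRegular R rs := by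
  let s : Set ℕ∞ := {c | ∃ rs : List R, c = rs.length ∧ (∀ y ∈ rs, y ∈ maximalIdeal R) ∧
    IsRegular R rs}
  have hne : Nonempty s := ⟨0, [], rfl, by simp, by simp [isRegular_iff]⟩
  refine ENat.sSup_mem_of_nonempty_of_lt_top (s := s) ?_
  obtain ⟨D, hD⟩ := WithBot.ne_bot_iff_exists.1 (ringKrullDim_ne_bot (R := R))
  have hDtop : D ≠ ⊤ := by
    rintro rfl
    exact ringKrullDim_ne_top (R := R) hD.symm
  refine lt_of_le_of_lt (sSup_le (a := D) ?_) hDtop.lt_top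
  rintro _ ⟨rs, rfl, hm, hrs⟩
  have h := ringKrullDim_add_length_eq_ringKrullDim_of_isRegular rs hrs
  have : Nontrivial (R ⧸ Ideal.ofList rs) := Ideal.Quotient.nontrivial_iff.2 fun htop =>
    (maximalIdeal.isMaximal R).ne_top (top_le_iff.1 (htop ▸ Ideal.span_le.2 hm))
  have h' : (rs.length : WithBot ℕ∞) ≤ D := by
    rw [hD, ← h]
    exact le_add_of_nonneg_left ringKrullDim_nonneg_of_nontrivial
  exact_mod_cast h'

lemma primesEmbed_of_ringDepth_eq {r : ℕ} (hr : ringDepth R = r)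
    (hacm : ringKrullDim R ≤ ((ringDepth R + 1 : ℕ∞) : WithBot ℕ∞)) : PrimesEmbed R r := by
  classical
  intro p hp
  obtain ⟨rs₀, hlen₀, hm₀, hrs₀⟩ := exists_length_eq_ringDepth R
  have hD : DepthGE R R r := by
    have := depthGE_of_isRegular hm₀ hrs₀
    rwa [show rs₀.length = r by exact_mod_cast hlen₀.symm.trans hr] at this
  let P : ℕ → Prop := fun t => ∃ rs : List R, rs.length = t ∧ (∀ y ∈ rs, y ∈ p) ∧
    IsWeaklyRegular R rs
  have hpm : p ≤ maximalIdeal R := le_maximalIdeal hp.ne_top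
  have hPr : ∀ t, P t → t ≤ r := by
    rintro _ ⟨rs, rfl, hm, hrs⟩
    have := length_le_ringDepth (fun y hy => hpm (hm y hy)) hrs
    rw [hr] at this
    exact_mod_cast this
  obtain ⟨rs, hlen, hm, hrs⟩ : P (Nat.findGreatest P r) :=
    Nat.findGreatest_spec (P := P) (Nat.zero_le r) ⟨[], rfl, by simp, by simp⟩
  have hmax : ∀ t, P t → t ≤ rs.length := fun t ht =>
    (Nat.le_findGreatest (hPr t ht) ht).trans hlen.ge
  have hrsr : rs.length ≤ r := hPr _ ⟨rs, rfl, hm, hrs⟩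
  have hmm : ∀ y ∈ rs, y ∈ maximalIdeal R := fun y hy => hpm (hm y hy)
  have hreg : IsRegular R rs :=
    (IsLocalRing.isRegular_iff_isWeaklyRegular_of_subset_maximalIdeal hmm).2 hrs
  refine ⟨rs, hrs, hmm, hrsr, ?_⟩
  suffices hass : IsAssociatedPrime p (R ⧸ (Ideal.ofList rs • ⊤ : Submodule R R)) from
    ((isAssociatedPrime_iff_exists_injective_linearMap _ _).1 hass).2
  have hnz : ¬ Subsingleton ((R ⧸ p) →ₗ[R] R ⧸ (Ideal.ofList rs • ⊤ : Submodule R R)) := by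
    intro hsub
    obtain ⟨y, hy, hyT⟩ := IsSMulRegular.subsingleton_linearMap_iff.1 hsub
    rw [Ideal.annihilator_quotient] at hy
    have := hmax (rs.length + 1) ⟨rs ++ [y], by simp, by
      intro z hz
      rcases List.mem_append.1 hz with hz | hz
      · exact hm z hz
      · rwa [List.mem_singleton.1 hz], by
      rw [isWeaklyRegular_append_iff]
      exact ⟨hrs, by simpa using hyT⟩⟩
    omega
  rw [not_subsingleton_iff_nontrivial] at hnz
  obtain ⟨f, hf⟩ := exists_ne (0 : (R ⧸ p) →ₗ[R] R ⧸ (Ideal.ofList rs • ⊤ : Submodule R R))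
  have hf1 : f 1 ≠ 0 := fun h1 => hf <| LinearMap.ext fun z => by
    obtain ⟨a, rfl⟩ := Ideal.Quotient.mk_surjective z
    have := f.map_smul a 1
    rw [h1, smul_zero] at this
    simpa [Algebra.smul_def] using this
  obtain ⟨q, hq, hle⟩ := exists_le_isAssociatedPrime_of_isNoetherianRing R (f 1) hf1
  have hpq : p ≤ q := fun a ha => hle (by
    have ha' : a • (1 : R ⧸ p) = 0 := by
      rw [Algebra.smul_def, mul_one]
      exact Ideal.Quotient.eq_zero_iff_mem.2 ha
    rw [Submodule.mem_colon_singleton, Submodule.mem_bot, ← map_smul, ha', map_zero])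
  obtain ⟨k, rfl⟩ := Nat.exists_eq_add_of_le' hrsr
  have hk := (hD.quotient_ofList hrs).le_ringKrullDim_quotient hq
  rcases hpq.eq_or_lt with rfl | hlt
  · exact hq
  apply Module.associatedPrimes.minimalPrimes_annihilator_subset_associatedPrimes
  rw [smul_eq_mul, Ideal.mul_top, Ideal.annihilator_quotient]
  refine ⟨⟨hp, Ideal.span_le.2 hm⟩, fun p' hp' hp'p => ?_⟩
  by_contra hne
  have hp'' := hp'.1
  have h1 := ringKrullDim_quotient_succ_le_of_lt hlt
  have h2 := ringKrullDim_quotient_succ_le_of_lt (lt_of_le_not_ge hp'p hne)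
  have h3 : ringKrullDim (R ⧸ p') ≤ ringKrullDim (R ⧸ Ideal.ofList rs) :=
    ringKrullDim_le_of_surjective _ (Ideal.Quotient.factor_surjective hp'.2)
  have h4 := ringKrullDim_add_length_eq_ringKrullDim_of_isRegular rs hreg
  have h5 : ((k + 1 + 1 + rs.length : ℕ) : WithBot ℕ∞) ≤ ((k + rs.length + 1 : ℕ) : WithBot ℕ∞) :=
    calc ((k + 1 + 1 + rs.length : ℕ) : WithBot ℕ∞)
        = (k : WithBot ℕ∞) + 1 + 1 + rs.length := by push_cast; rfl
      _ ≤ ringKrullDim (R ⧸ q) + 1 + 1 + rs.length := by gcongr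
      _ ≤ ringKrullDim (R ⧸ p) + 1 + rs.length := by gcongr
      _ ≤ ringKrullDim (R ⧸ p') + rs.length := by gcongr
      _ ≤ ringKrullDim (R ⧸ Ideal.ofList rs) + rs.length := by gcongr
      _ ≤ _ := h4.le.trans hacm
      _ = _ := by rw [hr]; push_cast; rfl
  have : k + 1 + 1 + rs.length ≤ k + rs.length + 1 := by exact_mod_cast h5
  omega

end Depth

lemma gid_le_iff {R : Type u} [CommRing R] {M : Type u} [AddCommGroup M] [Module R M] {n : ℕ} :
    Gid R M ≤ n ↔ ∃ m ≤ n, GidLE R m M := by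
  constructor
  · intro h
    by_contra! hcon
    have h' : ((n + 1 : ℕ) : ℕ∞) ≤ Gid R M := by
      refine le_sInf ?_
      rintro _ ⟨m, rfl, hm⟩
      by_contra hlt
      rw [Nat.cast_le, not_le] at hlt
      exact hcon m (by omega) (gidLE_iff.2 hm)
    have := h'.trans h
    rw [Nat.cast_le] at this
    omega
  · rintro ⟨m, hmn, hm⟩
    have h : Gid R M ≤ (m : ℕ∞) := sInf_le ⟨m, rfl, gidLE_iff.1 hm⟩
    exact h.trans (Nat.cast_le.2 hmn)

lemma GidLE.gid_le {R : Type u} [CommRing R] {M : Type u} [AddCommGroup M] [Module R M] {n : ℕ}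
    (h : GidLE R n M) : Gid R M ≤ n :=
  gid_le_iff.2 ⟨n, le_rfl, h⟩

lemma exists_gid_eq {R : Type u} [CommRing R] {M : Type u} [AddCommGroup M] [Module R M]
    (h : Gid R M ≠ ⊤) : ∃ n : ℕ, Gid R M = n ∧ GidLE R n M := by
  obtain ⟨n, hn⟩ := ENat.ne_top_iff_exists.1 h
  obtain ⟨m, hmn, hm⟩ := gid_le_iff.1 hn.ge
  have := hn.le.trans hm.gid_le
  rw [Nat.cast_le] at this
  obtain rfl : m = n := le_antisymm hmn this
  exact ⟨m, hn.symm, hm⟩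

/-- Nakayama's lemma along a local homomorphism. -/
lemma smul_top_ne_top_of_le_maximalIdeal (R S : Type u) [CommRing R] [CommRing S] [IsLocalRing R]
    [IsLocalRing S] [Algebra R S] [IsLocalHom (algebraMap R S)] (M : Type u) [AddCommGroup M]
    [Module S M] [Module R M] [IsScalarTower R S M] [Module.Finite S M] [Nontrivial M]
    {I : Ideal R} (hI : I ≤ maximalIdeal R) : I • ⊤ ≠ (⊤ : Submodule R M) := by
  intro h
  have hle : (⊤ : Submodule S M) ≤ maximalIdeal S • ⊤ := by
    rintro m -
    have hm : m ∈ I • (⊤ : Submodule R M) := h.ge trivial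
    induction hm using Submodule.smul_induction_on' with
    | smul a ha z _ =>
      rw [← algebraMap_smul S a z]
      exact Submodule.smul_mem_smul
        (map_nonunit (algebraMap R S) a (hI ha)) trivial
    | add y _ z _ hy hz => exact add_mem hy hz
  exact top_ne_bot (α := Submodule S M) <| Submodule.eq_bot_of_le_smul_of_le_jacobson_bot _ _
    Module.Finite.fg_top hle (maximalIdeal_le_jacobson _)

theorem gid_quotient_eq_of_almost_cohenMacaulay (R S : Type u) [CommRing R] [CommRing S] [IsNoetherianRing R] [IsNoetherianRing S]
    [IsLocalRing R] [IsLocalRing S] [Algebra R S] [IsLocalHom (algebraMap R S)]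
    (M : Type u) [AddCommGroup M] [Module S M] [Module R M] [IsScalarTower R S M] [Module.Finite S M]
    (hacm : ringKrullDim R ≤ ((ringDepth R + 1 : ℕ∞) : WithBot ℕ∞))
    (x : R) (hx : x ∈ IsLocalRing.maximalIdeal R)
    (hxR : x ∈ nonZeroDivisors R) (hxM : IsSMulRegular M x)
    (hfin : Gid R M ≠ ⊤) :
    Gid (R ⧸ Ideal.span {x}) (M ⧸ (Ideal.span {x} • ⊤ : Submodule R M)) = Gid R M - 1 := by
  rcases subsingleton_or_nontrivial M with hM | hM
  · have : Subsingleton (M ⧸ (Ideal.span {x} • ⊤ : Submodule R M)) :=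
      (Submodule.mkQ_surjective _).subsingleton
    have h0 : Gid R M ≤ (0 : ℕ) :=
      GidLE.gid_le (n := 0) (isGorensteinInjective_of_subsingleton M)
    have h1 : Gid (R ⧸ Ideal.span {x}) (M ⧸ (Ideal.span {x} • ⊤ : Submodule R M)) ≤ (0 : ℕ) :=
      GidLE.gid_le (n := 0) (isGorensteinInjective_of_subsingleton _)
    rw [Nat.cast_zero, nonpos_iff_eq_zero] at h0 h1
    rw [h0, h1, zero_tsub]
  obtain ⟨n, hn, hnM⟩ := exists_gid_eq hfin
  have hxspan : Ideal.span {x} ≤ maximalIdeal R := (Ideal.span_singleton_le_iff_mem _).2 hx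
  obtain ⟨n, rfl⟩ : ∃ m, n = m + 1 := by
    refine Nat.exists_eq_succ_of_ne_zero ?_
    rintro rfl
    refine smul_top_ne_top_of_le_maximalIdeal R S M hxspan (top_le_iff.1 fun m _ => ?_)
    obtain ⟨z, rfl⟩ := IsGorensteinInjective.exists_smul_eq x hxR hnM m
    exact Submodule.smul_mem_smul (Ideal.mem_span_singleton_self x) trivial
  obtain ⟨rs₀, hr, hm₀, hrs₀⟩ := exists_length_eq_ringDepth R
  have hnr : n + 1 ≤ rs₀.length := by
    have := hn.ge.trans (hnM.le_of_primesEmbed (primesEmbed_of_ringDepth_eq hr hacm)).gid_le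
    exact_mod_cast this
  obtain ⟨r, hr'⟩ := Nat.exists_eq_add_of_le' (le_of_add_le_right hnr)
  have hxreg : IsSMulRegular R x := Module.Flat.isSMulRegular_of_nonZeroDivisors hxR
  have : Nontrivial (QuotSMulTop x R) := by
    rw [Submodule.Quotient.nontrivial_iff, ← Submodule.ideal_span_singleton_smul]
    exact smul_top_ne_top_of_le_maximalIdeal R R R hxspan
  obtain ⟨rs, hlen, hm, hrs⟩ :=
    ((hr' ▸ depthGE_of_isRegular hm₀ hrs₀).quotSMulTop hxreg).exists_isRegular
  have hcons : RingTheory.Sequence.IsWeaklyRegular R (x :: rs) :=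
    (RingTheory.Sequence.isWeaklyRegular_cons_iff R x rs).2 ⟨hxreg, hrs.toIsWeaklyRegular⟩
  have hle := (GidLE.quotient x hxR hxM hnM).gid_le
  obtain ⟨k, hk, hkM⟩ := exists_gid_eq (ne_top_of_le_ne_top (ENat.natCast_ne_top n) hle)
  have hrk := GidLE.length_le (isWeaklyRegular_quotient_of_cons hcons) hkM fun h =>
    smul_top_ne_top_of_le_maximalIdeal R S M (Ideal.span_le.2 fun y (hy : y ∈ x :: rs) => by
      rcases List.mem_cons.1 hy with rfl | hy
      exacts [hx, hm y hy])
      (ofList_cons_smul_eq_top h)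
  rw [List.length_map] at hrk
  rw [hk, Nat.cast_le] at hle
  obtain rfl : k = n := by omega
  rw [hk, hn]
  norm_cast


end
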